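/- arXiv:1212.4597 — 2 statements merged into one kernel-verified Lean document; each statement's English description precedes it below -/
import Mathlib

section
/- The T-ideal I_n of all quasi-identities of M_n is finitely generated as a T-ideal: there exists a finite subset S of I_n, each of whose elements involves only the noncommuting variables x_1,…,x_{2n²} and the commutative variables x_{ij}^{(k)} with k ≤ 2n², such that the T-ideal of C⟨X⟩ generated by S is equal to I_n. -/
open scoped TensorProduct

variable (F : Type*) [Field F] [CharZero F] (n : ℕ)

/-- The commutative coefficient ring `C = F[x_{ij}^{(k)}]`. -/
abbrev CPoly := MvPolynomial (Fin n × Fin n × ℕ) F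

/-- The algebra of quasi-polynomials `C⟨X⟩`. -/
abbrev QPoly := FreeAlgebra (CPoly F n) ℕ

/-- The generic matrix `ξ_k`. -/
noncomputable def genMat (k : ℕ) : Matrix (Fin n) (Fin n) (CPoly F n) :=
  Matrix.of fun i j => MvPolynomial.X (i, j, k)

/-- `Φ : C⟨X⟩ → M_n(C)`, the `C`-algebra map sending `x_k` to `ξ_k`. -/
noncomputable def PhiQ : QPoly F n →ₐ[CPoly F n] Matrix (Fin n) (Fin n) (CPoly F n) :=
  FreeAlgebra.lift _ (genMat F n)

/-- Evaluation of `C` at a sequence of matrices. -/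
noncomputable def evalC (A : ℕ → Matrix (Fin n) (Fin n) F) : CPoly F n →ₐ[F] F :=
  MvPolynomial.aeval fun p => A p.2.2 p.1 p.2.1

/-- Evaluation `ev_A : C⟨X⟩ → M_n(F)`. -/
noncomputable def evalQ (A : ℕ → Matrix (Fin n) (Fin n) F) :
    QPoly F n →ₐ[F] Matrix (Fin n) (Fin n) F :=
  ((evalC F n A).mapMatrix).comp ((PhiQ F n).restrictScalars F)

def IsQuasiIdentity (P : QPoly F n) : Prop :=
  ∀ A : ℕ → Matrix (Fin n) (Fin n) F, evalQ F n A P = 0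

/-- Substitution endomorphisms of `C⟨X⟩`. -/
def IsSubstEndo (φ : QPoly F n →ₐ[F] QPoly F n) : Prop :=
  ∀ (i j : Fin n) (k : ℕ),
    φ (algebraMap (CPoly F n) (QPoly F n) (MvPolynomial.X (i, j, k))) =
      algebraMap (CPoly F n) (QPoly F n) (PhiQ F n (φ (FreeAlgebra.ι (CPoly F n) k)) i j)

def IsTIdeal (I : Set (QPoly F n)) : Prop :=
  (0 : QPoly F n) ∈ I ∧
  (∀ a b : QPoly F n, a ∈ I → b ∈ I → a + b ∈ I) ∧
  (∀ r a : QPoly F n, a ∈ I → r * a ∈ I) ∧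
  (∀ r a : QPoly F n, a ∈ I → a * r ∈ I) ∧
  (∀ φ : QPoly F n →ₐ[F] QPoly F n, IsSubstEndo F n φ → ∀ p ∈ I, φ p ∈ I)

/-- The T-ideal generated by a set. -/
def TIdealSpan (S : Set (QPoly F n)) : Set (QPoly F n) :=
  ⋂₀ {I : Set (QPoly F n) | IsTIdeal F n I ∧ S ⊆ I}

/-- The Cayley–Hamilton quasi-polynomial `q_n`. -/
noncomputable def chQ : QPoly F n :=
  ∑ i ∈ Finset.range (n + 1),
    algebraMap (CPoly F n) (QPoly F n) ((genMat F n 0).charpoly.coeff i) *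
      FreeAlgebra.ι (CPoly F n) 0 ^ i

/-- Noncommutative polynomials over `F`. -/
abbrev NCPoly := FreeAlgebra F ℕ

noncomputable def evalNC (A : ℕ → Matrix (Fin n) (Fin n) F) :
    NCPoly F →ₐ[F] Matrix (Fin n) (Fin n) F :=
  FreeAlgebra.lift F A

def IsCentralPoly (c : NCPoly F) : Prop :=
  ∀ A : ℕ → Matrix (Fin n) (Fin n) F, ∃ α : F,
    evalNC F n A c = α • (1 : Matrix (Fin n) (Fin n) F)

def IsPolyIdentity (c : NCPoly F) : Prop :=
  ∀ A : ℕ → Matrix (Fin n) (Fin n) F, evalNC F n A c = 0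

/-- The constant term of a noncommutative polynomial. -/
noncomputable def constantTerm : NCPoly F →ₐ[F] F :=
  FreeAlgebra.lift F (fun _ : ℕ => (0 : F))

/-- The inclusion `F⟨X⟩ → C⟨X⟩`. -/
noncomputable def toQPoly : NCPoly F →ₐ[F] QPoly F n :=
  FreeAlgebra.lift F (fun k => FreeAlgebra.ι (CPoly F n) k)

/-- The subalgebra of quasi-polynomials involving only the first `m` noncommuting
variables and the commutative variables `x_{ij}^{(k)}` with `k < m`. -/
noncomputable def usesOnlyVars (m : ℕ) : Subalgebra F (QPoly F n) :=
  Algebra.adjoin F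
    ({p : QPoly F n | ∃ k < m, p = FreeAlgebra.ι (CPoly F n) k} ∪
     {p : QPoly F n | ∃ (i j : Fin n), ∃ k < m,
        p = algebraMap (CPoly F n) (QPoly F n) (MvPolynomial.X (i, j, k))})

section
open Finset Equiv

theorem Equiv.Perm.exists_lt_apply_of_ne_one {N : ℕ} {ρ : Perm (Fin N)} (h : ρ ≠ 1) :
    ∃ p, (∀ q < p, ρ q = q) ∧ p < ρ p := by
  have hex : ∃ p, ρ p ≠ p := by
    by_contra! hc
    exact h (Equiv.ext hc)
  obtain ⟨p, hp, hmin⟩ := WellFounded.has_min (wellFounded_lt (α := Fin N)) {p | ρ p ≠ p} hex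
  have hfix : ∀ q < p, ρ q = q := fun q hq => by
    by_contra hne
    exact hmin q hne hq
  refine ⟨p, hfix, lt_of_le_of_ne (le_of_not_gt fun hlt => hp ?_) (Ne.symm hp)⟩
  exact ρ.injective (hfix _ hlt)

theorem Equiv.Perm.exists_coloring_of_no_strictAnti {N h : ℕ} (σ : Perm (Fin N))
    (hσ : ∀ a : Fin (h + 1) ↪o Fin N, ¬ StrictAnti (σ ∘ a)) :
    ∃ c : Fin N → Fin h, ∀ p q, p < q → c p = c q → σ p < σ q := by
  classical
  let chains : Fin N → Finset (Finset (Fin N)) := fun p =>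
    univ.filter fun A => StrictAntiOn σ A ∧ p ∈ A ∧ ∀ x ∈ A, x ≤ p
  let len : Fin N → ℕ := fun p => (chains p).sup card
  have hle : ∀ p, len p ≤ h := fun p => by
    refine Finset.sup_le fun A hA => ?_
    obtain ⟨hanti, -, -⟩ := (mem_filter.1 hA).2
    by_contra! hlt
    obtain ⟨B, hBA, hB⟩ := exists_subset_card_eq (Nat.succ_le_of_lt hlt)
    refine hσ (B.orderEmbOfFin hB) fun i j hij => ?_
    exact hanti (hBA (B.orderEmbOfFin_mem hB i)) (hBA (B.orderEmbOfFin_mem hB j))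
      ((B.orderEmbOfFin hB).strictMono hij)
  have hpos : ∀ p, 1 ≤ len p := fun p => by
    have : ({p} : Finset (Fin N)) ∈ chains p := by simp [chains]
    exact (card_singleton p).ge.trans (Finset.le_sup (f := card) this)
  have hstep : ∀ p q, p < q → σ q < σ p → len p < len q := fun p q hpq hlt => by
    have hne : (chains p).Nonempty := ⟨{p}, by simp [chains]⟩
    obtain ⟨A, hA, hAc⟩ := Finset.exists_mem_eq_sup _ hne card
    obtain ⟨hanti, hpA, hAp⟩ := (mem_filter.1 hA).2
    have hqA : q ∉ A := fun hq => absurd (hAp q hq) (not_le.2 hpq)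
    have hmem : insert q A ∈ chains q := by
      refine mem_filter.2 ⟨mem_univ _, ?_, mem_insert_self _ _, ?_⟩
      · intro x hx y hy hxy
        rw [mem_coe, mem_insert] at hx hy
        rcases hx with rfl | hx <;> rcases hy with rfl | hy
        · exact absurd hxy (lt_irrefl _)
        · exact absurd (hxy.trans_le (hAp y hy)) (not_lt.2 hpq.le)
        · exact hlt.trans_le (hanti.antitoneOn hx hpA (hAp x hx))
        · exact hanti hx hy hxy
      · intro x hx
        rcases mem_insert.1 hx with rfl | hx
        exacts [le_rfl, (hAp x hx).trans hpq.le]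
    have := Finset.le_sup (f := card) hmem
    rw [card_insert_of_notMem hqA] at this
    change (chains p).sup card < (chains q).sup card
    omega
  refine ⟨fun p => ⟨len p - 1, by have := hle p; have := hpos p; omega⟩, fun p q hpq hc => ?_⟩
  by_contra hn
  have hlt : σ q < σ p := lt_of_le_of_ne (not_lt.1 hn) fun he => hpq.ne' (σ.injective he)
  have h1 := hstep p q hpq hlt
  have h2 := hpos p
  have h3 := hpos q
  simp only [Fin.mk.injEq] at hc
  omega

theorem Equiv.Perm.sum_sign_viaEmbedding_eq_zero {N h : ℕ} (a : Fin (h + 1) ↪ Fin N)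
    (c : Fin N → Fin h) (z : Perm (Fin N)) :
    ∑ τ : Perm (Fin (h + 1)),
      (if c ∘ z ∘ τ.viaEmbedding a = c then (((Perm.sign τ : ℤˣ) : ℤ) : ℚ) else 0) = 0 := by
  classical
  obtain ⟨p, q, hpq, hc⟩ := Fintype.exists_ne_map_eq_of_card_lt (fun j => c (a j)) (by simp)
  refine Finset.sum_involution (fun τ _ => τ * Equiv.swap p q) ?_ ?_ (by simp) (by simp)
  · intro τ _
    have hswap : c ∘ (Equiv.swap p q).viaEmbedding a = c := by
      funext x
      by_cases hx : x ∈ Set.range a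
      · obtain ⟨j, rfl⟩ := hx
        simp only [Function.comp_apply, Perm.viaEmbedding_apply]
        by_cases hj : j = p
        · subst hj; simpa using hc.symm
        by_cases hj' : j = q
        · subst hj'; simpa using hc
        rw [Equiv.swap_apply_of_ne_of_ne hj hj']
      · simp [Perm.viaEmbedding_apply_of_notMem _ _ _ hx]
    have hinv : (Equiv.swap p q).viaEmbedding a * (Equiv.swap p q).viaEmbedding a = 1 := by
      rw [← Perm.viaEmbeddingHom_apply, ← map_mul, Equiv.swap_mul_self, map_one]
    have hmul : (τ * Equiv.swap p q).viaEmbedding a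
        = τ.viaEmbedding a * (Equiv.swap p q).viaEmbedding a := by
      simp only [← Perm.viaEmbeddingHom_apply, map_mul]
    have hiff : c ∘ z ∘ (τ * Equiv.swap p q).viaEmbedding a = c ↔
        c ∘ z ∘ τ.viaEmbedding a = c := by
      rw [hmul, Perm.coe_mul]
      constructor <;> intro hh
      · calc c ∘ z ∘ τ.viaEmbedding a
            = (c ∘ z ∘ τ.viaEmbedding a ∘ (Equiv.swap p q).viaEmbedding a) ∘
                (Equiv.swap p q).viaEmbedding a := by
              have := congrArg (fun e : Perm (Fin N) => c ∘ z ∘ τ.viaEmbedding a ∘ e) hinv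
              simpa [Perm.coe_mul, Function.comp_assoc] using this.symm
          _ = c := by rw [hh, hswap]
      · calc c ∘ z ∘ τ.viaEmbedding a ∘ (Equiv.swap p q).viaEmbedding a
            = (c ∘ z ∘ τ.viaEmbedding a) ∘ (Equiv.swap p q).viaEmbedding a := rfl
          _ = c := by rw [hh, hswap]
    simp only [hiff, Perm.sign_mul, Perm.sign_swap hpq]
    split_ifs <;> simp
  · intro τ _ _ he
    rw [mul_eq_left, Equiv.swap_eq_one_iff] at he
    exact hpq he

/-- The alternating sum over a translate of the symmetric group on the range of `a`. -/
noncomputable def altVec {N r : ℕ} (a : Fin r ↪ Fin N) (x : Perm (Fin N)) :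
    Perm (Fin N) → ℚ :=
  ∑ τ : Perm (Fin r), (((Perm.sign τ : ℤˣ) : ℤ) : ℚ) • Pi.single (x * τ.viaEmbedding a) 1

/-- The sum over a translate of the stabilizer of a coloring. -/
noncomputable def symVec {N h : ℕ} (c : Fin N → Fin h) (x : Perm (Fin N)) :
    Perm (Fin N) → ℚ :=
  ∑ η ∈ Finset.univ.filter fun η : Perm (Fin N) => c ∘ η = c, Pi.single (x * η) 1

theorem sum_mul_altVec {N r : ℕ} (a : Fin r ↪ Fin N) (x : Perm (Fin N))
    (u : Perm (Fin N) → ℚ) :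
    ∑ σ, u σ * altVec a x σ =
      ∑ τ : Perm (Fin r), (((Perm.sign τ : ℤˣ) : ℤ) : ℚ) * u (x * τ.viaEmbedding a) := by
  simp only [altVec, Finset.sum_apply, Pi.smul_apply, Pi.single_apply, Finset.mul_sum, smul_eq_mul]
  rw [Finset.sum_comm]
  refine Finset.sum_congr rfl fun τ _ => ?_
  simp [mul_comm]

theorem sum_mul_symVec {N h : ℕ} (c : Fin N → Fin h) (x : Perm (Fin N))
    (u : Perm (Fin N) → ℚ) :
    ∑ σ, u σ * symVec c x σ =
      ∑ η ∈ Finset.univ.filter fun η : Perm (Fin N) => c ∘ η = c, u (x * η) := by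
  simp only [symVec, Finset.sum_apply, Pi.single_apply, Finset.mul_sum]
  rw [Finset.sum_comm]
  refine Finset.sum_congr rfl fun τ _ => ?_
  simp

theorem altVec_orthogonal_symVec {N h : ℕ} (a : Fin (h + 1) ↪ Fin N) (c : Fin N → Fin h)
    (x y : Perm (Fin N)) : ∑ σ, altVec a x σ * symVec c y σ = 0 := by
  classical
  simp_rw [mul_comm]
  rw [sum_mul_altVec, ← Perm.sum_sign_viaEmbedding_eq_zero a c (y⁻¹ * x)]
  refine Finset.sum_congr rfl fun τ _ => ?_
  have : symVec c y (x * τ.viaEmbedding a) =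
      if c ∘ (y⁻¹ * x : Perm (Fin N)) ∘ τ.viaEmbedding a = c then 1 else 0 := by
    simp only [symVec, Finset.sum_apply, Pi.single_apply]
    have hiff : ∀ η : Perm (Fin N), x * τ.viaEmbedding a = y * η ↔
        η = y⁻¹ * x * τ.viaEmbedding a := fun η => by
      rw [mul_assoc, eq_inv_mul_iff_mul_eq, eq_comm]
    simp only [hiff, Finset.sum_ite_eq', Finset.mem_filter, Finset.mem_univ, true_and]
    rfl
  rw [this, mul_ite, mul_one, mul_zero]

theorem Equiv.Perm.viaEmbedding_one {α β : Type*} (a : α ↪ β) :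
    (1 : Perm α).viaEmbedding a = 1 := by
  rw [← Perm.viaEmbeddingHom_apply, map_one]

theorem Equiv.Perm.toLex_mul_viaEmbedding_lt {N r : ℕ} {σ : Perm (Fin N)} {a : Fin r ↪o Fin N}
    (hσ : StrictAnti (σ ∘ a)) {τ : Perm (Fin r)} (hτ : τ ≠ 1) :
    toLex ((σ * τ.viaEmbedding a.toEmbedding : Perm (Fin N)) : Fin N → Fin N) < toLex ⇑σ := by
  obtain ⟨p, hp, hlt⟩ := Perm.exists_lt_apply_of_ne_one hτ
  refine ⟨a p, fun q hq => ?_, ?_⟩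
  · change σ (τ.viaEmbedding a.toEmbedding q) = σ q
    congr 1
    by_cases hx : q ∈ Set.range a.toEmbedding
    · obtain ⟨j, rfl⟩ := hx
      rw [Perm.viaEmbedding_apply, hp j (a.lt_iff_lt.1 hq)]
    · exact Perm.viaEmbedding_apply_of_notMem _ _ _ hx
  · change σ (τ.viaEmbedding a.toEmbedding (a.toEmbedding p)) < σ (a p)
    rw [Perm.viaEmbedding_apply]
    exact hσ hlt

theorem Equiv.Perm.lt_toLex_mul {N h : ℕ} {σ : Perm (Fin N)} {c : Fin N → Fin h}
    (hc : ∀ p q, p < q → c p = c q → σ p < σ q) {η : Perm (Fin N)} (hη : c ∘ η = c)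
    (hne : η ≠ 1) : toLex ⇑σ < toLex ((σ * η : Perm (Fin N)) : Fin N → Fin N) := by
  obtain ⟨p, hp, hlt⟩ := Perm.exists_lt_apply_of_ne_one hne
  refine ⟨p, fun q hq => ?_, ?_⟩
  · change σ q = σ (η q)
    rw [hp q hq]
  · exact hc _ _ hlt (congrFun hη p).symm

theorem span_altVec_symVec (N h : ℕ) :
    Submodule.span ℚ ({f | ∃ (a : Fin (h + 1) ↪ Fin N) (x : Perm (Fin N)), f = altVec a x} ∪
      {f | ∃ (c : Fin N → Fin h) (x : Perm (Fin N)), f = symVec c x}) = ⊤ := by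
  classical
  set J := Submodule.span ℚ
    {f | ∃ (a : Fin (h + 1) ↪ Fin N) (x : Perm (Fin N)), f = altVec a x} with hJ
  let good : Perm (Fin N) → Prop := fun σ => ∀ a : Fin (h + 1) ↪o Fin N, ¬ StrictAnti (σ ∘ a)
  let key : Perm (Fin N) → Lex (Fin N → Fin N) := fun σ => toLex ⇑σ
  have hwf : WellFounded fun σ τ : Perm (Fin N) => key σ < key τ :=
    Finite.wellFounded_of_trans_of_irrefl (α := Perm (Fin N)) _
  let U : Submodule ℚ (Perm (Fin N) → ℚ) :=
    { carrier := {g | ∀ σ, ¬ good σ → g σ = 0}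
      add_mem' := fun {f g} hf hg σ hσ => by simp [hf σ hσ, hg σ hσ]
      zero_mem' := fun σ _ => rfl
      smul_mem' := fun t f hf σ hσ => by simp [hf σ hσ] }
  have hsingle : ∀ σ : Perm (Fin N), Pi.single σ (1 : ℚ) ∈ J ⊔ U := by
    intro σ
    induction σ using hwf.induction with
    | _ σ ih =>
      by_cases hg : good σ
      · refine Submodule.mem_sup_right fun τ hτ => ?_
        rw [Pi.single_apply, if_neg]
        rintro rfl
        exact hτ hg
      · simp only [good, not_forall, not_not] at hg
        obtain ⟨a, ha⟩ := hg
        have h1 : altVec a.toEmbedding σ ∈ J ⊔ U :=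
          Submodule.mem_sup_left (Submodule.subset_span ⟨_, _, rfl⟩)
        rw [altVec, ← Finset.add_sum_erase _ _ (Finset.mem_univ 1)] at h1
        rw [Submodule.add_mem_iff_left] at h1
        · simpa [Perm.viaEmbedding_one] using h1
        · refine Submodule.sum_mem _ fun τ hτ => Submodule.smul_mem _ _ (ih _ ?_)
          exact Perm.toLex_mul_viaEmbedding_lt ha (Finset.ne_of_mem_erase hτ)
  have hJU : J ⊔ U = ⊤ := by
    rw [eq_top_iff, ← (Pi.basisFun ℚ (Perm (Fin N))).span_eq, Submodule.span_le]
    rintro _ ⟨σ, rfl⟩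
    simpa using hsingle σ
  have horth : ∀ j ∈ J, ∀ (c : Fin N → Fin h) (x : Perm (Fin N)),
      ∑ σ, j σ * symVec c x σ = 0 := by
    intro j hj c x
    induction hj using Submodule.span_induction with
    | mem f hf =>
      obtain ⟨a, y, rfl⟩ := hf
      exact altVec_orthogonal_symVec a c y x
    | zero => simp
    | add f g _ _ hf hg => simp [add_mul, Finset.sum_add_distrib, hf, hg]
    | smul t f _ hf => simp [mul_assoc, ← Finset.mul_sum, hf]
  by_contra hne
  obtain ⟨l, hl0, hl⟩ := Submodule.exists_le_ker_of_lt_top _ (lt_top_iff_ne_top.2 hne)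
  rw [Submodule.span_union, ← hJ] at hl
  let u : Perm (Fin N) → ℚ := fun σ => l (Pi.single σ 1)
  have hlu : ∀ f, l f = ∑ σ, u σ * f σ := fun f => by
    conv_lhs => rw [LinearMap.pi_apply_eq_sum_univ l f]
    refine Finset.sum_congr rfl fun σ _ => ?_
    rw [smul_eq_mul, mul_comm]
    congr 2
    funext τ
    simp [Pi.single_apply, eq_comm]
  obtain ⟨j, hj, g, hg, hjg⟩ := Submodule.mem_sup.1 (hJU ▸ Submodule.mem_top : u ∈ J ⊔ U)
  have hgB : ∀ (c : Fin N → Fin h) (x : Perm (Fin N)), ∑ σ, g σ * symVec c x σ = 0 := by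
    intro c x
    have h1 : l (symVec c x) = 0 :=
      hl (Submodule.mem_sup_right (Submodule.subset_span ⟨c, x, rfl⟩))
    rw [hlu, ← hjg] at h1
    simpa [add_mul, Finset.sum_add_distrib, horth j hj c x] using h1
  have hg0 : g = 0 := by
    by_contra hne
    obtain ⟨σ₀, hσ₀⟩ := Function.ne_iff.1 hne
    obtain ⟨σ, hσ, hmax⟩ := Finset.exists_max_image
      (Finset.univ.filter fun σ : Perm (Fin N) => g σ ≠ 0) key ⟨σ₀, by simpa using hσ₀⟩
    have hσ := (Finset.mem_filter.1 hσ).2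
    have hgood : good σ := by
      by_contra hb
      exact hσ (hg σ hb)
    obtain ⟨c, hc⟩ := Perm.exists_coloring_of_no_strictAnti σ hgood
    have h1 := hgB c σ
    rw [sum_mul_symVec, Finset.sum_eq_single 1] at h1
    · exact hσ (by simpa using h1)
    · intro η hη hη1
      by_contra hb
      exact absurd (Perm.lt_toLex_mul hc (Finset.mem_filter.1 hη).2 hη1)
        (not_lt.2 (hmax _ (by simpa using hb)))
    · simp
  have hu : l u = 0 := by
    have : u = j := by rw [← hjg, hg0, add_zero]
    exact hl (Submodule.mem_sup_left (this ▸ hj))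
  rw [hlu, Finset.sum_eq_zero_iff_of_nonneg fun σ _ => mul_self_nonneg _] at hu
  refine hl0 (LinearMap.ext fun f => ?_)
  rw [hlu]
  refine Finset.sum_eq_zero fun σ hσ => ?_
  rw [mul_self_eq_zero.1 (hu σ hσ), zero_mul]

end

section

set_option linter.unusedSectionVars false

variable {F n}

theorem FreeAlgebra.exists_ringHom_of_commRing {R X : Type*} [CommRing R] (g : R →+* R)
    (H : X → FreeAlgebra R X) :
    ∃ φ : FreeAlgebra R X →+* FreeAlgebra R X,
      (∀ c, φ (algebraMap R _ c) = algebraMap R _ (g c)) ∧ ∀ x, φ (FreeAlgebra.ι R x) = H x := by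
  let e := FreeAlgebra.equivMonoidAlgebraFreeMonoid (R := R) (X := X)
  let l : FreeAlgebra R X →+* FreeAlgebra R X := (FreeAlgebra.lift R H).toRingHom
  let m : MonoidAlgebra R (FreeMonoid X) →+* MonoidAlgebra R (FreeMonoid X) :=
    MonoidAlgebra.mapRingHom _ g
  let es : MonoidAlgebra R (FreeMonoid X) →+* FreeAlgebra R X := e.symm.toRingEquiv.toRingHom
  let ee : FreeAlgebra R X →+* MonoidAlgebra R (FreeMonoid X) := e.toRingEquiv.toRingHom
  refine ⟨(l.comp es).comp (m.comp ee), fun c => ?_, fun x => ?_⟩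
  · have h1 : ee (algebraMap R _ c) = algebraMap R _ c := e.commutes c
    have h2 : m (algebraMap R _ c) = algebraMap R _ (g c) := by
      simp [m, MonoidAlgebra.coe_algebraMap]
    have h3 : es (algebraMap R _ (g c)) = algebraMap R _ (g c) := e.symm.commutes _
    have h4 : l (algebraMap R _ (g c)) = algebraMap R _ (g c) := AlgHom.commutes _ _
    simp only [RingHom.comp_apply, h1, h2, h3, h4]
  · have h1 : ee (FreeAlgebra.ι R x) = MonoidAlgebra.of R _ (FreeMonoid.of x) := by
      simp [ee, e, FreeAlgebra.equivMonoidAlgebraFreeMonoid]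
    have h2 : m (MonoidAlgebra.of R _ (FreeMonoid.of x)) =
        MonoidAlgebra.of R _ (FreeMonoid.of x) := by
      simp [m]
    have h3 : es (MonoidAlgebra.of R _ (FreeMonoid.of x)) = FreeAlgebra.ι R x := by
      rw [← h1]; exact e.symm_apply_apply _
    have h4 : l (FreeAlgebra.ι R x) = H x := FreeAlgebra.lift_ι_apply _ _
    simp only [RingHom.comp_apply, h1, h2, h3, h4]

theorem exists_isSubstEndo (H : ℕ → QPoly F n) :
    ∃ φ : QPoly F n →ₐ[F] QPoly F n, IsSubstEndo F n φ ∧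
      ∀ k, φ (FreeAlgebra.ι (CPoly F n) k) = H k := by
  let g : CPoly F n →ₐ[F] CPoly F n := MvPolynomial.aeval fun p => PhiQ F n (H p.2.2) p.1 p.2.1
  obtain ⟨φ, hφ, hx⟩ := FreeAlgebra.exists_ringHom_of_commRing g.toRingHom H
  refine ⟨{ φ with commutes' := fun r => ?_ }, fun i j k => ?_, hx⟩
  · change φ (algebraMap F (QPoly F n) r) = _
    rw [IsScalarTower.algebraMap_apply F (CPoly F n) (QPoly F n), hφ]
    congr 1
    exact g.commutes r
  · change φ _ = algebraMap _ _ (PhiQ F n (φ _) i j)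
    rw [hφ, hx]
    congr 1
    exact MvPolynomial.aeval_X _ _

theorem adjoin_variables_eq_top :
    Algebra.adjoin F
      (Set.range (FreeAlgebra.ι (CPoly F n) : ℕ → QPoly F n) ∪
        Set.range fun p : Fin n × Fin n × ℕ =>
          algebraMap (CPoly F n) (QPoly F n) (MvPolynomial.X p)) = ⊤ := by
  rw [eq_top_iff]
  set W := Algebra.adjoin F
      (Set.range (FreeAlgebra.ι (CPoly F n) : ℕ → QPoly F n) ∪
        Set.range fun p : Fin n × Fin n × ℕ =>
          algebraMap (CPoly F n) (QPoly F n) (MvPolynomial.X p))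
  have hC : ∀ c : CPoly F n, algebraMap (CPoly F n) (QPoly F n) c ∈ W := by
    intro c
    induction c using MvPolynomial.induction_on with
    | C a =>
      have : algebraMap (CPoly F n) (QPoly F n) (MvPolynomial.C a) = algebraMap F _ a := rfl
      rw [this]
      exact W.algebraMap_mem a
    | add p q hp hq => rw [map_add]; exact W.add_mem hp hq
    | mul_X p i hp =>
      rw [map_mul]
      exact W.mul_mem hp (Algebra.subset_adjoin (Or.inr ⟨i, rfl⟩))
  intro P _
  induction P using FreeAlgebra.induction with
  | grade0 r => exact hC r
  | grade1 x => exact Algebra.subset_adjoin (Or.inl ⟨x, rfl⟩)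
  | mul a b ha hb => exact W.mul_mem (ha trivial) (hb trivial)
  | add a b ha hb => exact W.add_mem (ha trivial) (hb trivial)

theorem PhiQ_ι (k : ℕ) : PhiQ F n (FreeAlgebra.ι (CPoly F n) k) = genMat F n k :=
  FreeAlgebra.lift_ι_apply _ _

theorem PhiQ_algebraMap (c : CPoly F n) :
    PhiQ F n (algebraMap (CPoly F n) (QPoly F n) c) = algebraMap _ _ c :=
  AlgHom.commutes _ _

theorem isQuasiIdentity_iff (P : QPoly F n) : IsQuasiIdentity F n P ↔ PhiQ F n P = 0 := by
  constructor
  · intro h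
    refine Matrix.ext fun i j => MvPolynomial.funext fun v => ?_
    have := congrFun (congrFun (h fun k => Matrix.of fun i j => v (i, j, k)) i) j
    rw [Matrix.zero_apply, map_zero]
    exact this
  · intro h A
    simp [evalQ, h]

theorem IsSubstEndo.PhiQ_apply {φ : QPoly F n →ₐ[F] QPoly F n} (hφ : IsSubstEndo F n φ) :
    ∃ g : CPoly F n →ₐ[F] CPoly F n, ∀ P, PhiQ F n (φ P) = (PhiQ F n P).map g := by
  let g : CPoly F n →ₐ[F] CPoly F n :=
    MvPolynomial.aeval fun p => PhiQ F n (φ (FreeAlgebra.ι _ p.2.2)) p.1 p.2.1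
  refine ⟨g, fun P => ?_⟩
  have : ((PhiQ F n).restrictScalars F).comp φ =
      g.mapMatrix.comp ((PhiQ F n).restrictScalars F) := by
    refine AlgHom.ext_of_adjoin_eq_top adjoin_variables_eq_top ?_
    rintro _ (⟨k, rfl⟩ | ⟨⟨i, j, k⟩, rfl⟩)
    · ext i j : 2
      simp [PhiQ_ι, genMat, g]
    · simp only [AlgHom.comp_apply, AlgHom.restrictScalars_apply]
      rw [hφ i j k, PhiQ_algebraMap, PhiQ_algebraMap]
      ext a b : 2
      by_cases hab : a = b <;> simp [Matrix.algebraMap_matrix_apply, g, hab]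
  exact DFunLike.congr_fun this P

theorem isTIdeal_quasiIdentities : IsTIdeal F n {P | IsQuasiIdentity F n P} := by
  simp only [isQuasiIdentity_iff]
  refine ⟨by simp, fun a b ha hb => ?_, fun r a ha => ?_, fun r a ha => ?_, fun φ hφ p hp => ?_⟩
  · simp_all
  · simp_all
  · simp_all
  · obtain ⟨g, hg⟩ := hφ.PhiQ_apply
    simp only [Set.mem_ofPred_eq] at hp ⊢
    rw [hg, hp]
    ext
    simp

theorem isTIdeal_TIdealSpan (S : Set (QPoly F n)) : IsTIdeal F n (TIdealSpan F n S) := by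
  refine ⟨fun I hI => hI.1.1, fun a b ha hb I hI => hI.1.2.1 a b (ha I hI) (hb I hI),
    fun r a ha I hI => hI.1.2.2.1 r a (ha I hI), fun r a ha I hI => hI.1.2.2.2.1 r a (ha I hI),
    fun φ hφ p hp I hI => hI.1.2.2.2.2 φ hφ p (hp I hI)⟩

/-- A T-ideal as an `F`-subspace. -/
def IsTIdeal.toSubmodule {I : Set (QPoly F n)} (hI : IsTIdeal F n I) :
    Submodule F (QPoly F n) where
  carrier := I
  add_mem' := fun {a b} ha hb => hI.2.1 a b ha hb
  zero_mem' := hI.1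
  smul_mem' := fun c x hx => by
    rw [Algebra.smul_def]
    exact hI.2.2.1 _ _ hx

/-- The factor that a slot of a monomial contributes: a noncommutative slot keeps the inserted
quasi-polynomial, the slot `(i, j)` takes the `(i, j)` entry of its image under `Φ`. -/
noncomputable def slotMap (t : Option (Fin n × Fin n)) : QPoly F n →ₗ[F] QPoly F n :=
  match t with
  | none => LinearMap.id
  | some (i, j) => (Algebra.linearMap (CPoly F n) (QPoly F n)).restrictScalars F ∘ₗ
      Matrix.entryLinearMap F (CPoly F n) i j ∘ₗ ((PhiQ F n).restrictScalars F).toLinearMap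

theorem slotMap_none (P : QPoly F n) : slotMap (none : Option (Fin n × Fin n)) P = P := rfl

theorem slotMap_some (i j : Fin n) (P : QPoly F n) :
    slotMap (some (i, j)) P = algebraMap (CPoly F n) (QPoly F n) (PhiQ F n P i j) := rfl

/-- The multilinear map attached to a sequence of slots. -/
noncomputable def slotProd {N : ℕ} (s : Fin N → Option (Fin n × Fin n)) :
    MultilinearMap F (fun _ : Fin N => QPoly F n) (QPoly F n) :=
  (MultilinearMap.mkPiAlgebraFin F N (QPoly F n)).compLinearMap fun p => slotMap (s p)

theorem slotProd_apply {N : ℕ} (s : Fin N → Option (Fin n × Fin n)) (H : Fin N → QPoly F n) :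
    slotProd s H = (List.ofFn fun p => slotMap (s p) (H p)).prod := by
  simp [slotProd, MultilinearMap.mkPiAlgebraFin_apply]

variable (F n) in
/-- The span of the slot products with permuted arguments. -/
noncomputable def natMaps (N : ℕ) :
    Submodule F (MultilinearMap F (fun _ : Fin N => QPoly F n) (QPoly F n)) :=
  Submodule.span F {E | ∃ (s : Fin N → Option (Fin n × Fin n)) (σ : Equiv.Perm (Fin N)),
    E = (slotProd s).domDomCongr σ}

theorem slotProd_mem_natMaps {N : ℕ} (s : Fin N → Option (Fin n × Fin n)) :
    (slotProd s : MultilinearMap F (fun _ : Fin N => QPoly F n) (QPoly F n)) ∈ natMaps F n N :=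
  Submodule.subset_span ⟨s, 1, rfl⟩

theorem domDomCongr_mem_natMaps {N : ℕ}
    {E : MultilinearMap F (fun _ : Fin N => QPoly F n) (QPoly F n)} (hE : E ∈ natMaps F n N)
    (σ : Equiv.Perm (Fin N)) : E.domDomCongr σ ∈ natMaps F n N := by
  induction hE using Submodule.span_induction with
  | mem E hE =>
    obtain ⟨s, τ, rfl⟩ := hE
    exact Submodule.subset_span ⟨s, τ.trans σ, rfl⟩
  | zero => exact Submodule.zero_mem _
  | add E E' _ _ h h' => exact Submodule.add_mem _ h h'
  | smul c E _ h => exact Submodule.smul_mem _ c h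

theorem IsSubstEndo.map_slotMap_ι {φ : QPoly F n →ₐ[F] QPoly F n} (hφ : IsSubstEndo F n φ)
    (t : Option (Fin n × Fin n)) (k : ℕ) :
    φ (slotMap t (FreeAlgebra.ι _ k)) = slotMap t (φ (FreeAlgebra.ι _ k)) := by
  rcases t with _ | ⟨i, j⟩
  · rfl
  · rw [slotMap_some, slotMap_some, ← hφ i j k, PhiQ_ι]
    rfl

theorem IsSubstEndo.map_natMap {φ : QPoly F n →ₐ[F] QPoly F n} (hφ : IsSubstEndo F n φ) {N : ℕ}
    {E : MultilinearMap F (fun _ : Fin N => QPoly F n) (QPoly F n)} (hE : E ∈ natMaps F n N)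
    (κ : Fin N → ℕ) :
    φ (E fun p => FreeAlgebra.ι _ (κ p)) = E fun p => φ (FreeAlgebra.ι _ (κ p)) := by
  induction hE using Submodule.span_induction with
  | mem E hE =>
    obtain ⟨s, τ, rfl⟩ := hE
    simp only [MultilinearMap.domDomCongr_apply, slotProd_apply, map_list_prod, List.map_ofFn]
    congr 2
    funext p
    exact hφ.map_slotMap_ι _ _
  | zero => simp
  | add E E' _ _ h h' => simp [h, h']
  | smul c E _ h => simp [h]

theorem IsTIdeal.subst_mem {I : Set (QPoly F n)} (hI : IsTIdeal F n I) {N : ℕ}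
    {E : MultilinearMap F (fun _ : Fin N => QPoly F n) (QPoly F n)} (hE : E ∈ natMaps F n N)
    {κ : Fin N → ℕ} (h : E (fun p => FreeAlgebra.ι _ (κ p)) ∈ I) (H : ℕ → QPoly F n) :
    E (fun p => H (κ p)) ∈ I := by
  obtain ⟨φ, hφ, hH⟩ := exists_isSubstEndo H
  have := hI.2.2.2.2 φ hφ _ h
  rw [hφ.map_natMap hE] at this
  simpa only [hH] using this

/-- Inserting arbitrary quasi-polynomials into a multilinear element of a T-ideal. -/
theorem IsTIdeal.subst_fin_mem {I : Set (QPoly F n)} (hI : IsTIdeal F n I) {N : ℕ}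
    {E : MultilinearMap F (fun _ : Fin N => QPoly F n) (QPoly F n)} (hE : E ∈ natMaps F n N)
    (h : E (fun p => FreeAlgebra.ι _ (p : ℕ)) ∈ I) (H : Fin N → QPoly F n) : E H ∈ I := by
  have := hI.subst_mem hE h fun k => if hk : k < N then H ⟨k, hk⟩ else 0
  simpa using this

/-- Polarization: the part of a multilinear map that permutes the arguments within the fibres
of `κ` is an alternating sum of restitutions along `κ`. -/
theorem MultilinearMap.sum_stabilizer_eq {R M M' α : Type*} [CommRing R] [AddCommMonoid M]
    [AddCommGroup M'] [Module R M] [Module R M'] [DecidableEq α] {N : ℕ}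
    (E : MultilinearMap R (fun _ : Fin N => M) M') (X : Fin N → M) (κ : Fin N → α) :
    ∑ η ∈ Finset.univ.filter fun η : Equiv.Perm (Fin N) => κ ∘ η = κ, E (fun p => X (η p)) =
      ∑ S : Finset (Fin N), (-1 : R) ^ Sᶜ.card •
        E (fun p => ∑ i ∈ S.filter fun i => κ i = κ p, X i) := by
  classical
  have hpi : ∀ S : Finset (Fin N), (Fintype.piFinset fun p => S.filter fun i => κ i = κ p) =
      Finset.univ.filter fun r : Fin N → Fin N => κ ∘ r = κ ∧ ∀ p, r p ∈ S := fun S => by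
    ext r
    simp only [Fintype.mem_piFinset, Finset.mem_filter, Finset.mem_univ, true_and,
      funext_iff, Function.comp_apply]
    exact ⟨fun h => ⟨fun p => (h p).2, fun p => (h p).1⟩, fun h p => ⟨h.2 p, h.1 p⟩⟩
  have hinner : ∀ r : Fin N → Fin N,
      ∑ S : Finset (Fin N), (if ∀ p, r p ∈ S then (-1 : R) ^ Sᶜ.card else 0) =
        if Function.Surjective r then 1 else 0 := fun r => by
    have h1 : ∑ S : Finset (Fin N), (if ∀ p, r p ∈ S then (-1 : R) ^ Sᶜ.card else 0) =
        ∑ U : Finset (Fin N), if U ⊆ (Finset.univ.image r)ᶜ then (-1 : R) ^ U.card else 0 := by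
      refine Fintype.sum_equiv (Function.Involutive.toPerm compl compl_involutive) _ _ fun S => ?_
      have : (∀ p, r p ∈ S) ↔ Sᶜ ⊆ (Finset.univ.image r)ᶜ := by
        simp [Finset.subset_iff]
      simp [this]
    rw [h1, ← Finset.sum_filter]
    have h2 : (Finset.univ.filter fun U => U ⊆ (Finset.univ.image r)ᶜ) =
        ((Finset.univ.image r)ᶜ).powerset := by
      ext U; simp
    have h3 : (Finset.univ.image r)ᶜ = ∅ ↔ Function.Surjective r := by
      rw [Finset.compl_eq_empty_iff, Finset.eq_univ_iff_forall]; simp [Function.Surjective]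
    have h4 := congrArg (Int.cast : ℤ → R)
      (Finset.sum_powerset_neg_one_pow_card (x := (Finset.univ.image r)ᶜ))
    rw [h2]
    simpa [h3] using h4
  simp only [MultilinearMap.map_sum_finset, hpi, Finset.smul_sum]
  have hswap : ∀ S : Finset (Fin N),
      ∑ r ∈ Finset.univ.filter (fun r : Fin N → Fin N => κ ∘ r = κ ∧ ∀ p, r p ∈ S),
        (-1 : R) ^ Sᶜ.card • E (fun p => X (r p)) =
      ∑ r ∈ Finset.univ.filter (fun r : Fin N → Fin N => κ ∘ r = κ),
        (if ∀ p, r p ∈ S then (-1 : R) ^ Sᶜ.card else 0) • E (fun p => X (r p)) := fun S => by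
    rw [← Finset.filter_filter, Finset.sum_filter]
    refine Finset.sum_congr rfl fun r _ => ?_
    split_ifs <;> simp
  rw [Finset.sum_congr rfl fun S _ => hswap S, Finset.sum_comm]
  simp only [← Finset.sum_smul, hinner]
  simp only [ite_smul, one_smul, zero_smul]
  rw [← Finset.sum_filter, Finset.filter_filter]
  refine Finset.sum_bij (fun η _ => ⇑η) ?_ ?_ ?_ ?_
  · intro η hη
    simp only [Finset.mem_filter, Finset.mem_univ, true_and] at hη ⊢
    exact ⟨hη, η.surjective⟩
  · intro η _ η' _ h
    exact DFunLike.coe_injective h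
  · intro r hr
    simp only [Finset.mem_filter, Finset.mem_univ, true_and] at hr
    exact ⟨Equiv.ofBijective r (Finite.injective_iff_bijective.1
      (Finite.injective_iff_surjective.2 hr.2)), by simpa using hr.1, rfl⟩
  · intro η _
    rfl

theorem IsTIdeal.sum_stabilizer_mem {I : Set (QPoly F n)} (hI : IsTIdeal F n I) {N : ℕ}
    {E : MultilinearMap F (fun _ : Fin N => QPoly F n) (QPoly F n)} (hE : E ∈ natMaps F n N)
    {κ : Fin N → ℕ} (h : E (fun p => FreeAlgebra.ι _ (κ p)) ∈ I) :
    ∑ η ∈ Finset.univ.filter fun η : Equiv.Perm (Fin N) => κ ∘ η = κ,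
      E (fun p => FreeAlgebra.ι _ (η p : ℕ)) ∈ I := by
  rw [E.sum_stabilizer_eq (fun p => FreeAlgebra.ι _ (p : ℕ)) κ]
  refine hI.toSubmodule.sum_mem fun S _ => Submodule.smul_mem _ _ ?_
  exact hI.subst_mem hE h fun k => ∑ i ∈ S.filter fun i => κ i = k, FreeAlgebra.ι _ (i : ℕ)

theorem sum_cast_altVec_smul {N r : ℕ} {M : Type*} [AddCommMonoid M] [Module F M]
    (a : Fin r ↪ Fin N) (x : Equiv.Perm (Fin N)) (v : Equiv.Perm (Fin N) → M) :
    ∑ σ, ((altVec a x σ : ℚ) : F) • v σ =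
      ∑ τ : Equiv.Perm (Fin r),
        (((Equiv.Perm.sign τ : ℤˣ) : ℤ) : F) • v (x * τ.viaEmbedding a) := by
  simp only [altVec, Finset.sum_apply, Pi.smul_apply, Pi.single_apply, Rat.cast_sum, smul_eq_mul,
    Finset.sum_smul]
  rw [Finset.sum_comm]
  refine Finset.sum_congr rfl fun τ _ => ?_
  rw [Finset.sum_eq_single (x * τ.viaEmbedding a)]
  · simp
  · intro σ _ hσ
    simp [hσ]
  · simp

theorem sum_cast_symVec_smul {N h : ℕ} {M : Type*} [AddCommMonoid M] [Module F M]
    (c : Fin N → Fin h) (x : Equiv.Perm (Fin N)) (v : Equiv.Perm (Fin N) → M) :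
    ∑ σ, ((symVec c x σ : ℚ) : F) • v σ =
      ∑ η ∈ Finset.univ.filter fun η : Equiv.Perm (Fin N) => c ∘ η = c, v (x * η) := by
  simp only [symVec, Finset.sum_apply, Pi.single_apply, Rat.cast_sum, Finset.sum_smul]
  rw [Finset.sum_comm]
  refine Finset.sum_congr rfl fun η _ => ?_
  rw [Finset.sum_eq_single (x * η)]
  · simp
  · intro σ _ hσ
    simp [hσ]
  · simp

/-- The alternating sum of a multilinear map over the arguments in the range of `a`. -/
noncomputable def altMap {N r : ℕ} (a : Fin r ↪ Fin N)
    (E : MultilinearMap F (fun _ : Fin N => QPoly F n) (QPoly F n)) :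
    MultilinearMap F (fun _ : Fin N => QPoly F n) (QPoly F n) :=
  ∑ τ : Equiv.Perm (Fin r), (((Equiv.Perm.sign τ : ℤˣ) : ℤ) : F) • E.domDomCongr (τ.viaEmbedding a)

theorem altMap_apply {N r : ℕ} (a : Fin r ↪ Fin N)
    (E : MultilinearMap F (fun _ : Fin N => QPoly F n) (QPoly F n)) (H : Fin N → QPoly F n) :
    altMap a E H = ∑ τ : Equiv.Perm (Fin r), (((Equiv.Perm.sign τ : ℤˣ) : ℤ) : F) •
      E (fun p => H (τ.viaEmbedding a p)) := by
  simp only [altMap, _root_.sum_apply, _root_.smul_apply,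
    MultilinearMap.domDomCongr_apply]

theorem altMap_mem_natMaps {N r : ℕ} (a : Fin r ↪ Fin N)
    {E : MultilinearMap F (fun _ : Fin N => QPoly F n) (QPoly F n)} (hE : E ∈ natMaps F n N) :
    altMap a E ∈ natMaps F n N :=
  Submodule.sum_mem _ fun _ _ => Submodule.smul_mem _ _ (domDomCongr_mem_natMaps hE _)

/-- `I` contains the quasi-identities in the first `m` variables. -/
def ContainsSmall (m : ℕ) (I : Set (QPoly F n)) : Prop :=
  ∀ P ∈ usesOnlyVars F n m, IsQuasiIdentity F n P → P ∈ I

theorem natMap_mem_usesOnlyVars {m N : ℕ}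
    {E : MultilinearMap F (fun _ : Fin N => QPoly F n) (QPoly F n)} (hE : E ∈ natMaps F n N)
    {κ : Fin N → ℕ} (hκ : ∀ p, κ p < m) :
    E (fun p => FreeAlgebra.ι _ (κ p)) ∈ usesOnlyVars F n m := by
  induction hE using Submodule.span_induction with
  | mem E hE =>
    obtain ⟨s, τ, rfl⟩ := hE
    rw [MultilinearMap.domDomCongr_apply, slotProd_apply]
    refine Subalgebra.list_prod_mem _ fun P hP => ?_
    obtain ⟨p, rfl⟩ := (List.mem_ofFn' _ _).1 hP
    change slotMap (s p) (FreeAlgebra.ι _ (κ (τ p))) ∈ _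
    rcases s p with _ | ⟨i, j⟩
    · exact Algebra.subset_adjoin (Or.inl ⟨_, hκ _, rfl⟩)
    · refine Algebra.subset_adjoin (Or.inr ⟨i, j, _, hκ (τ p), ?_⟩)
      rw [slotMap_some, PhiQ_ι]
      rfl
  | zero => exact Subalgebra.zero_mem _
  | add E E' _ _ h h' => exact Subalgebra.add_mem _ h h'
  | smul c E _ h => exact Subalgebra.smul_mem _ h c

theorem natMap_mem_of_altMap_mem {I : Set (QPoly F n)} (hI : IsTIdeal F n I) {m : ℕ}
    (hm : ContainsSmall m I) {N : ℕ}
    {E : MultilinearMap F (fun _ : Fin N => QPoly F n) (QPoly F n)} (hE : E ∈ natMaps F n N)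
    (hid : IsQuasiIdentity F n (E fun p => FreeAlgebra.ι _ (p : ℕ)))
    (halt : ∀ a : Fin (m + 1) ↪ Fin N, altMap a E (fun p => FreeAlgebra.ι _ (p : ℕ)) ∈ I) :
    E (fun p => FreeAlgebra.ι _ (p : ℕ)) ∈ I := by
  let v : Equiv.Perm (Fin N) → QPoly F n := fun σ => E fun p => FreeAlgebra.ι _ (σ p : ℕ)
  let K : Submodule ℚ (Equiv.Perm (Fin N) → ℚ) :=
    { carrier := {f | ∑ σ, ((f σ : ℚ) : F) • v σ ∈ hI.toSubmodule}
      add_mem' := fun {f g} hf hg => by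
        have := Submodule.add_mem hI.toSubmodule hf hg
        simpa [add_smul, Finset.sum_add_distrib] using this
      zero_mem' := by simp
      smul_mem' := fun t f hf => by
        have := Submodule.smul_mem hI.toSubmodule (t : F) hf
        simpa [Finset.smul_sum, smul_smul] using this }
  have hK : K = ⊤ := by
    rw [eq_top_iff, ← span_altVec_symVec N m, Submodule.span_le]
    rintro _ (⟨a, x, rfl⟩ | ⟨c, x, rfl⟩)
    · change ∑ σ, _ ∈ hI.toSubmodule
      rw [sum_cast_altVec_smul]
      have := hI.subst_fin_mem (altMap_mem_natMaps a hE) (halt a)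
        fun p => FreeAlgebra.ι _ (x p : ℕ)
      rwa [altMap_apply] at this
    · change ∑ σ, _ ∈ hI.toSubmodule
      rw [sum_cast_symVec_smul]
      have h1 : IsQuasiIdentity F n (E fun p => FreeAlgebra.ι _ (c p : ℕ)) :=
        isTIdeal_quasiIdentities.subst_fin_mem hE hid fun p => FreeAlgebra.ι _ (c p : ℕ)
      have h2 := hI.sum_stabilizer_mem hE
        (hm _ (natMap_mem_usesOnlyVars hE (κ := fun p => (c p : ℕ)) fun p => (c p).2) h1)
      have h3 : (∑ η ∈ Finset.univ.filter fun η : Equiv.Perm (Fin N) => c ∘ η = c,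
          E.domDomCongr η) ∈ natMaps F n N :=
        Submodule.sum_mem _ fun η _ => domDomCongr_mem_natMaps hE η
      have h4 := hI.subst_fin_mem h3 (by
        rw [_root_.sum_apply]
        simp only [MultilinearMap.domDomCongr_apply]
        convert h2 using 3
        simp [funext_iff, Fin.ext_iff]) fun p => FreeAlgebra.ι _ (x p : ℕ)
      rw [_root_.sum_apply] at h4
      exact h4
  have h1 : Pi.single 1 1 ∈ K := hK ▸ Submodule.mem_top
  change ∑ σ, _ ∈ hI.toSubmodule at h1
  rw [Finset.sum_eq_single 1] at h1
  · have h2 : E (fun p => FreeAlgebra.ι _ (p : ℕ)) ∈ hI.toSubmodule := by simpa [v] using h1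
    exact h2
  · intro σ _ hσ
    simp [hσ]
  · simp

theorem Equiv.Perm.viaEmbedding_mul {α β : Type*} (a : α ↪ β) (σ τ : Equiv.Perm α) :
    (σ * τ).viaEmbedding a = σ.viaEmbedding a * τ.viaEmbedding a := by
  simp only [← Equiv.Perm.viaEmbeddingHom_apply, map_mul]

theorem Equiv.Perm.sign_viaEmbedding {α β : Type*} [Fintype α] [DecidableEq α] [Fintype β]
    [DecidableEq β] (a : α ↪ β) (σ : Equiv.Perm α) :
    Equiv.Perm.sign (σ.viaEmbedding a) = Equiv.Perm.sign σ := by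
  classical
  rw [Equiv.Perm.viaEmbedding]
  exact (congrArg _ (by congr)).trans
    (Equiv.Perm.sign_extendDomain σ (Equiv.ofInjective a.1 a.2))

theorem Equiv.Perm.viaEmbedding_trans {α β γ : Type*} (c : α ↪ β) (b : β ↪ γ)
    (σ : Equiv.Perm α) : σ.viaEmbedding (c.trans b) = (σ.viaEmbedding c).viaEmbedding b := by
  ext x
  by_cases hx : x ∈ Set.range b
  · obtain ⟨y, rfl⟩ := hx
    rw [Equiv.Perm.viaEmbedding_apply]
    by_cases hy : y ∈ Set.range c
    · obtain ⟨z, rfl⟩ := hy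
      rw [Equiv.Perm.viaEmbedding_apply]
      exact Equiv.Perm.viaEmbedding_apply σ (c.trans b) z
    · rw [Equiv.Perm.viaEmbedding_apply_of_notMem _ _ _ hy,
        Equiv.Perm.viaEmbedding_apply_of_notMem]
      rintro ⟨z, hz⟩
      exact hy ⟨z, b.injective hz⟩
  · rw [Equiv.Perm.viaEmbedding_apply_of_notMem _ _ _ hx, Equiv.Perm.viaEmbedding_apply_of_notMem]
    rintro ⟨z, rfl⟩
    exact hx ⟨c z, rfl⟩

theorem Equiv.Perm.viaEmbedding_trans_equiv {α β : Type*} (a : α ↪ β) (σ : Equiv.Perm β)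
    (τ : Equiv.Perm α) (p : β) :
    σ (τ.viaEmbedding (a.trans σ.symm.toEmbedding) p) = τ.viaEmbedding a (σ p) := by
  by_cases hp : σ p ∈ Set.range a
  · obtain ⟨y, hy⟩ := hp
    have hp' : p = a.trans σ.symm.toEmbedding y := by simp [hy]
    rw [← hy, Equiv.Perm.viaEmbedding_apply, hp', Equiv.Perm.viaEmbedding_apply]
    simp
  · rw [Equiv.Perm.viaEmbedding_apply_of_notMem _ _ _ hp, Equiv.Perm.viaEmbedding_apply_of_notMem]
    rintro ⟨z, rfl⟩
    exact hp ⟨z, by simp⟩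

theorem altMap_comp_altMap {N r q : ℕ} (c : Fin q ↪ Fin r) (b : Fin r ↪ Fin N)
    (E : MultilinearMap F (fun _ : Fin N => QPoly F n) (QPoly F n)) (H : Fin N → QPoly F n) :
    altMap b (altMap (c.trans b) E) H = (Nat.factorial q : F) • altMap b E H := by
  simp only [altMap_apply, Finset.smul_sum]
  rw [Finset.sum_comm]
  have : ∀ ρ : Equiv.Perm (Fin q), ∑ τ : Equiv.Perm (Fin r),
      (((Equiv.Perm.sign τ : ℤˣ) : ℤ) : F) • (((Equiv.Perm.sign ρ : ℤˣ) : ℤ) : F) •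
        E (fun p => H (τ.viaEmbedding b (ρ.viaEmbedding (c.trans b) p))) =
      ∑ τ : Equiv.Perm (Fin r), (((Equiv.Perm.sign τ : ℤˣ) : ℤ) : F) •
        E (fun p => H (τ.viaEmbedding b p)) := fun ρ => by
    refine Fintype.sum_equiv (Equiv.mulRight (ρ.viaEmbedding c)) _ _ fun τ => ?_
    rw [smul_smul, Equiv.coe_mulRight, Equiv.Perm.viaEmbedding_mul,
      Equiv.Perm.viaEmbedding_trans, map_mul, Equiv.Perm.sign_viaEmbedding]
    push_cast
    rfl
  rw [Finset.sum_congr rfl fun ρ _ => this ρ]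
  simp [Fintype.card_perm, ← Nat.cast_smul_eq_nsmul F, Finset.smul_sum]

theorem IsTIdeal.altMap_mem {I : Set (QPoly F n)} (hI : IsTIdeal F n I) {N r : ℕ}
    (b : Fin r ↪ Fin N) {E : MultilinearMap F (fun _ : Fin N => QPoly F n) (QPoly F n)}
    (h : ∀ H, E H ∈ I) (H : Fin N → QPoly F n) : altMap b E H ∈ I := by
  rw [altMap_apply]
  exact hI.toSubmodule.sum_mem fun τ _ => Submodule.smul_mem _ _ (h _)

theorem IsTIdeal.mem_of_smul_mem {I : Set (QPoly F n)} (hI : IsTIdeal F n I) {c : F} (hc : c ≠ 0)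
    {P : QPoly F n} (h : c • P ∈ I) : P ∈ I := by
  have : c⁻¹ • (c • P) ∈ hI.toSubmodule := Submodule.smul_mem _ _ h
  rwa [inv_smul_smul₀ hc] at this

theorem IsTIdeal.altMap_mem_of_trans {I : Set (QPoly F n)} (hI : IsTIdeal F n I) {N r q : ℕ}
    (c : Fin q ↪ Fin r) (b : Fin r ↪ Fin N)
    {E : MultilinearMap F (fun _ : Fin N => QPoly F n) (QPoly F n)}
    (h : ∀ H, altMap (c.trans b) E H ∈ I) (H : Fin N → QPoly F n) : altMap b E H ∈ I := by
  refine hI.mem_of_smul_mem (c := (Nat.factorial q : F))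
    (Nat.cast_ne_zero.2 (Nat.factorial_ne_zero q)) ?_
  rw [← altMap_comp_altMap c b]
  exact hI.altMap_mem b h H

/-- The Capelli-type polynomial `∑ sgn(τ) h_{τ 0} y_0 h_{τ 1} y_1 ⋯`. -/
noncomputable def cap {r : ℕ} (h y : Fin r → QPoly F n) : QPoly F n :=
  ∑ τ : Equiv.Perm (Fin r), (((Equiv.Perm.sign τ : ℤˣ) : ℤ) : F) •
    (List.ofFn fun j => h (τ j) * y j).prod

theorem isQuasiIdentity_cap {r : ℕ} (hr : n ^ 2 < r) (h y : Fin r → QPoly F n) :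
    IsQuasiIdentity F n (cap h y) := by
  intro A
  let f := (MultilinearMap.mkPiAlgebraFin F r (Matrix (Fin n) (Fin n) F)).compLinearMap
    fun j => LinearMap.mulRight F (evalQ F n A (y j))
  have h1 : evalQ F n A (cap h y) =
      MultilinearMap.alternatization f fun j => evalQ F n A (h j) := by
    rw [MultilinearMap.alternatization_apply, cap, map_sum]
    refine Finset.sum_congr rfl fun τ _ => ?_
    rw [map_smul, map_list_prod, List.map_ofFn, Units.smul_def, Int.cast_smul_eq_zsmul]
    simp [f, MultilinearMap.mkPiAlgebraFin_apply, Function.comp_def]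
  rw [h1]
  refine AlternatingMap.map_linearDependent _ _ fun hli => ?_
  have := hli.fintype_card_le_finrank
  rw [Module.finrank_matrix] at this
  simp at this
  nlinarith

/-- Extracting a strictly increasing family of factors from an ordered product. -/
theorem List.exists_prod_ofFn_eq {R : Type*} [Monoid R] {N : ℕ} : ∀ {r : ℕ} {a : Fin r → Fin N}
    (_ : StrictMono a) (g : Fin N → R), ∃ (z : R) (y : Fin r → R), ∀ G : Fin N → R,
      (∀ p, p ∉ Set.range a → G p = g p) →
      (List.ofFn G).prod = z * (List.ofFn fun j => G (a j) * y j).prod := by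
  induction N with
  | zero =>
    intro r a ha g
    obtain rfl : r = 0 := by
      by_contra h
      exact (a ⟨0, Nat.pos_of_ne_zero h⟩).elim0
    exact ⟨1, fun _ => 1, fun G _ => by simp⟩
  | succ N ih =>
    intro r a ha g
    by_cases h0 : (0 : Fin (N + 1)) ∈ Set.range a
    · obtain ⟨j, hj⟩ := h0
      obtain ⟨r, rfl⟩ : ∃ r', r = r' + 1 := ⟨r - 1, by have := j.2; omega⟩
      have ha0 : a 0 = 0 := le_antisymm (hj ▸ ha.monotone (Fin.zero_le j)) (Fin.zero_le _)
      have hne : ∀ i : Fin r, a i.succ ≠ 0 := fun i => by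
        rw [← ha0]; exact (ha (Fin.succ_pos i)).ne'
      obtain ⟨z, y, hzy⟩ := ih (a := fun i => (a i.succ).pred (hne i))
        (fun i i' h => Fin.pred_lt_pred_iff.2 (ha (Fin.succ_lt_succ_iff.2 h)))
        fun p => g p.succ
      refine ⟨1, Fin.cons z y, fun G hG => ?_⟩
      rw [List.ofFn_succ, List.prod_cons, hzy (fun p => G p.succ), List.ofFn_succ, List.prod_cons]
      · simp [ha0, mul_assoc]
      · intro p hp
        refine hG _ ?_
        rintro ⟨i, hi⟩
        rcases Fin.eq_zero_or_eq_succ i with rfl | ⟨i, rfl⟩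
        · rw [ha0] at hi
          exact (Fin.succ_ne_zero p) hi.symm
        · exact hp ⟨i, by simp [hi]⟩
    · have hne : ∀ i : Fin r, a i ≠ 0 := fun i hi => h0 ⟨i, hi⟩
      obtain ⟨z, y, hzy⟩ := ih (a := fun i => (a i).pred (hne i))
        (fun i i' h => Fin.pred_lt_pred_iff.2 (ha h)) fun p => g p.succ
      refine ⟨g 0 * z, y, fun G hG => ?_⟩
      rw [List.ofFn_succ, List.prod_cons, hzy (fun p => G p.succ), hG 0 h0]
      · simp [mul_assoc]
      · intro p hp
        refine hG _ ?_
        rintro ⟨i, hi⟩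
        exact hp ⟨i, by simp [hi]⟩

theorem exists_altMap_slotProd_eq_mul_cap {N r : ℕ} (a : Fin r ↪ Fin N) (ha : StrictMono a)
    (s : Fin N → Option (Fin n × Fin n)) (hs : ∀ j, s (a j) = none) (H : Fin N → QPoly F n) :
    ∃ z y, altMap a (slotProd s) H = z * cap (fun j => H (a j)) y := by
  obtain ⟨z, y, hzy⟩ := List.exists_prod_ofFn_eq ha fun p => slotMap (s p) (H p)
  refine ⟨z, y, ?_⟩
  rw [altMap_apply, cap, Finset.mul_sum]
  refine Finset.sum_congr rfl fun τ _ => ?_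
  rw [slotProd_apply, hzy, mul_smul_comm]
  · simp [hs, slotMap_none, Equiv.Perm.viaEmbedding_apply]
  · intro p hp
    rw [Equiv.Perm.viaEmbedding_apply_of_notMem _ _ _ hp]

theorem List.prod_ofFn_two_mul {R : Type*} [Monoid R] (u : ℕ → R) (d : ℕ) :
    (List.ofFn fun p : Fin (2 * d + 1) => u p).prod * u (2 * d + 1) =
      (List.ofFn fun j : Fin (d + 1) => u (2 * j) * u (2 * j + 1)).prod := by
  induction d with
  | zero => simp
  | succ d ih =>
    rw [List.ofFn_succ_last (n := d + 1), List.prod_append]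
    simp only [Fin.val_castSucc, Fin.val_last]
    rw [← ih]
    change (List.ofFn fun p : Fin (2 * d + 1 + 1 + 1) => u p).prod * _ = _
    rw [List.ofFn_succ_last, List.ofFn_succ_last]
    simp [mul_assoc, Nat.mul_add]

theorem cap_mem {I : Set (QPoly F n)} {d : ℕ} (hd : d = n ^ 2) (hd1 : 1 ≤ d)
    (hI : IsTIdeal F n I) (hm : ContainsSmall (2 * d) I) (h y : Fin (d + 1) → QPoly F n) :
    cap h y ∈ I := by
  let s : ∀ N, Fin N → Option (Fin n × Fin n) := fun _ _ => none
  have hs : ∀ N H, slotProd (F := F) (s N) H = (List.ofFn H).prod := fun N H => by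
    simp [slotProd_apply, s, slotMap_none]
  have hvia : ∀ N (τ : Equiv.Perm (Fin N)) p,
      τ.viaEmbedding (Function.Embedding.refl (Fin N)) p = τ p := fun N τ p =>
    Equiv.Perm.viaEmbedding_apply τ (Function.Embedding.refl (Fin N)) p
  have hst : ∀ N H, altMap (Function.Embedding.refl _) (slotProd (F := F) (s N)) H =
      cap H 1 := fun N H => by
    rw [altMap_apply, cap]
    simp [hs, hvia]
  have hst1 : ∀ H, altMap (Function.Embedding.refl _) (slotProd (F := F) (s (2 * d))) H ∈ I := by
    refine fun H => hI.subst_fin_mem (altMap_mem_natMaps _ (slotProd_mem_natMaps _)) ?_ H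
    refine hm _ (natMap_mem_usesOnlyVars (altMap_mem_natMaps _ (slotProd_mem_natMaps _))
      fun p => p.2) ?_
    rw [hst]
    exact isQuasiIdentity_cap (by omega) _ _
  have hst2 : ∀ H, altMap (Fin.succEmb (2 * d)) (slotProd (F := F) (s (2 * d + 1))) H ∈ I := by
    intro H
    have h1 := hI.2.2.1 (H 0) _ (hst1 fun p => H p.succ)
    convert h1 using 1
    rw [altMap_apply, altMap_apply, Finset.mul_sum]
    refine Finset.sum_congr rfl fun τ _ => ?_
    have h0 : τ.viaEmbedding (Fin.succEmb (2 * d)) 0 = 0 :=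
      Equiv.Perm.viaEmbedding_apply_of_notMem _ _ _ (by simp)
    have hsucc : ∀ p : Fin (2 * d),
        τ.viaEmbedding (Fin.succEmb (2 * d)) p.succ = (τ p).succ := fun p =>
      Equiv.Perm.viaEmbedding_apply τ (Fin.succEmb (2 * d)) p
    rw [hs, hs, List.ofFn_succ, List.prod_cons, mul_smul_comm]
    simp [h0, hsucc, hvia]
  have hst3 : ∀ (b : Equiv.Perm (Fin (2 * d + 1))) H,
      altMap b.toEmbedding (slotProd (F := F) (s (2 * d + 1))) H ∈ I := by
    intro b
    refine hI.altMap_mem_of_trans ((Fin.succEmb (2 * d)).trans b.symm.toEmbedding) _ ?_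
    convert hst2
    ext
    simp
  obtain ⟨a, hav⟩ : ∃ a : Fin (d + 1) ↪ Fin (2 * d + 1), ∀ j, (a j : ℕ) = 2 * j :=
    ⟨⟨fun j => ⟨2 * j, by omega⟩, fun i j h => by simpa [Fin.ext_iff] using h⟩, fun _ => rfl⟩
  have ha : StrictMono a := fun i j h => by
    rw [Fin.lt_def] at h ⊢
    rw [hav, hav]
    omega
  have hcap : ∀ H, altMap a (slotProd (F := F) (s (2 * d + 1))) H ∈ I := by
    refine hI.subst_fin_mem (altMap_mem_natMaps _ (slotProd_mem_natMaps _)) ?_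
    refine natMap_mem_of_altMap_mem hI hm (altMap_mem_natMaps _ (slotProd_mem_natMaps _)) ?_ ?_
    · obtain ⟨z, y, hzy⟩ := exists_altMap_slotProd_eq_mul_cap (F := F) a ha (s _) (fun _ => rfl)
        fun p => FreeAlgebra.ι _ (p : ℕ)
      rw [hzy]
      exact isTIdeal_quasiIdentities.2.2.1 _ _ (isQuasiIdentity_cap (by omega) _ _)
    · intro b
      obtain ⟨b, rfl⟩ : ∃ e : Equiv.Perm (Fin (2 * d + 1)), b = e.toEmbedding :=
        ⟨Equiv.ofBijective b (Finite.injective_iff_bijective.1 b.injective), by ext; rfl⟩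
      have hab : a = (a.trans b.symm.toEmbedding).trans b.toEmbedding := by ext; simp
      rw [hab, altMap_comp_altMap]
      exact Submodule.smul_mem hI.toSubmodule _ (hst3 b _)
  let u : Equiv.Perm (Fin (d + 1)) → ℕ → QPoly F n := fun τ k =>
    if hk : k / 2 < d + 1 then
      if k % 2 = 0 then h (τ ⟨k / 2, hk⟩) else y ⟨k / 2, hk⟩
    else 0
  have h1 := hI.2.2.2.1 (y ⟨d, by omega⟩) _ (hcap fun p => u 1 p)
  convert h1 using 1
  rw [altMap_apply, cap, Finset.sum_mul]
  refine Finset.sum_congr rfl fun τ _ => ?_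
  have h2 : ∀ p : Fin (2 * d + 1), u 1 (τ.viaEmbedding a p : Fin _) = u τ p := by
    intro p
    by_cases hp : p ∈ Set.range a
    · obtain ⟨j, rfl⟩ := hp
      rw [Equiv.Perm.viaEmbedding_apply]
      have h4 : ∀ j : Fin (d + 1), (j : ℕ) ≤ d := fun j => by omega
      simp [u, hav, h4]
    · rw [Equiv.Perm.viaEmbedding_apply_of_notMem _ _ _ hp]
      have : (p : ℕ) % 2 ≠ 0 := fun h0 =>
        hp ⟨⟨p / 2, by omega⟩, Fin.ext (by rw [hav]; dsimp only; omega)⟩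
      simp [u, this]
  have h3 : u τ (2 * d + 1) = y ⟨d, by omega⟩ := by
    have : (2 * d + 1) / 2 = d := by omega
    simp [u, this]
  rw [hs, smul_mul_assoc, ← h3]
  simp only [h2]
  rw [List.prod_ofFn_two_mul]
  congr 3
  funext j
  have h4 : (2 * (j : ℕ) + 1) / 2 = j := by omega
  have h5 : (j : ℕ) ≤ d := by omega
  simp [u, h4, h5]

theorem List.prod_ofFn_eq_mul_update {R : Type*} [Monoid R] {N : ℕ} (G : Fin N → R) (p : Fin N)
    (hp : ∀ x, G p * x = x * G p) :
    (List.ofFn G).prod = G p * (List.ofFn (Function.update G p 1)).prod := by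
  induction N with
  | zero => exact p.elim0
  | succ N ih =>
    rw [List.ofFn_succ, List.ofFn_succ, List.prod_cons, List.prod_cons]
    rcases Fin.eq_zero_or_eq_succ p with rfl | ⟨p, rfl⟩
    · simp
    · rw [ih (fun i => G i.succ) p hp, ← mul_assoc, ← hp, mul_assoc]
      congr 2
      have : (fun i => Function.update G p.succ 1 i.succ) =
          Function.update (fun i => G i.succ) p 1 := by
        funext i
        by_cases h : i = p
        · simp [h]
        · simp [h]
      rw [this]

theorem List.prod_ofFn_swap {R : Type*} [Monoid R] {N : ℕ} (G : Fin N → R) {p q : Fin N}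
    (hpq : p ≠ q) (hp : ∀ x, G p * x = x * G p) (hq : ∀ x, G q * x = x * G q) :
    (List.ofFn fun i => G (Equiv.swap p q i)).prod = (List.ofFn G).prod := by
  have key : ∀ G : Fin N → R, (∀ x, G p * x = x * G p) → (∀ x, G q * x = x * G q) →
      (List.ofFn G).prod = G p * (G q *
        (List.ofFn (Function.update (Function.update G p 1) q 1)).prod) := fun G hp hq => by
    rw [List.prod_ofFn_eq_mul_update G p hp, List.prod_ofFn_eq_mul_update (Function.update G p 1) q]
    · rw [Function.update_of_ne hpq.symm]
    · rwa [Function.update_of_ne hpq.symm]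
  rw [key G hp hq, key _ (by simpa using hq) (by simpa using hp)]
  simp only [Equiv.swap_apply_left, Equiv.swap_apply_right]
  rw [← mul_assoc, ← mul_assoc, ← hp (G q)]
  congr 3
  funext i
  by_cases hiq : i = q
  · simp [hiq]
  by_cases hip : i = p
  · simp [hip, hpq]
  simp [hip, hiq, Equiv.swap_apply_of_ne_of_ne]

theorem altMap_slotProd_eq_zero {N r : ℕ} (a : Fin r ↪ Fin N)
    (s : Fin N → Option (Fin n × Fin n)) {p q : Fin r} (hpq : p ≠ q) {t : Fin n × Fin n}
    (hp : s (a p) = some t) (hq : s (a q) = some t) (H : Fin N → QPoly F n) :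
    altMap a (slotProd s) H = 0 := by
  rw [altMap_apply]
  refine Finset.sum_involution (fun τ _ => τ * Equiv.swap p q) ?_ ?_ ?_ ?_
  · intro τ _
    have hc : ∀ P x : QPoly F n, slotMap (some t) P * x = x * slotMap (some t) P := by
      obtain ⟨i, j⟩ := t
      intro P x
      rw [slotMap_some]
      exact Algebra.commutes _ _
    have h1 := List.prod_ofFn_swap (fun i => slotMap (s i) (H (τ.viaEmbedding a i)))
      (a.injective.ne hpq) (by simpa only [hp] using hc _) (by simpa only [hq] using hc _)
    have h2 : slotProd s (fun i => H ((τ * Equiv.swap p q).viaEmbedding a i)) =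
        slotProd s (fun i => H (τ.viaEmbedding a i)) := by
      rw [slotProd_apply, slotProd_apply, ← h1]
      congr 2
      funext i
      have hs : s (Equiv.swap (a p) (a q) i) = s i := by
        by_cases hip : i = a p
        · rw [hip, Equiv.swap_apply_left, hp, hq]
        by_cases hiq : i = a q
        · rw [hiq, Equiv.swap_apply_right, hp, hq]
        rw [Equiv.swap_apply_of_ne_of_ne hip hiq]
      have hv : (Equiv.swap p q).viaEmbedding a i = Equiv.swap (a p) (a q) i := by
        by_cases hi : i ∈ Set.range a
        · obtain ⟨j, rfl⟩ := hi
          rw [Equiv.Perm.viaEmbedding_apply, a.injective.map_swap]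
        · rw [Equiv.Perm.viaEmbedding_apply_of_notMem _ _ _ hi, Equiv.swap_apply_of_ne_of_ne]
          · rintro rfl
            exact hi ⟨p, rfl⟩
          · rintro rfl
            exact hi ⟨q, rfl⟩
      rw [hs, Equiv.Perm.viaEmbedding_mul, Equiv.Perm.mul_apply, hv]
    rw [h2, Equiv.Perm.sign_mul, Equiv.Perm.sign_swap hpq, ← add_smul]
    simp
  · intro τ _ _ h
    have := mul_eq_left.1 h
    exact hpq (Equiv.swap_eq_one_iff.1 this)
  · simp
  · intro τ _
    simp [mul_assoc]

theorem altMap_slotProd_mem {I : Set (QPoly F n)} {d : ℕ} (hd : d = n ^ 2) (hd1 : 1 ≤ d)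
    (hI : IsTIdeal F n I) (hm : ContainsSmall (2 * d) I) {N : ℕ} (a : Fin (2 * d + 1) ↪ Fin N)
    (s : Fin N → Option (Fin n × Fin n)) (H : Fin N → QPoly F n) :
    altMap a (slotProd s) H ∈ I := by
  classical
  by_cases hdup : ∃ p q, p ≠ q ∧ s (a p) ≠ none ∧ s (a p) = s (a q)
  · obtain ⟨p, q, hpq, hne, heq⟩ := hdup
    obtain ⟨t, ht⟩ := Option.ne_none_iff_exists'.1 hne
    rw [altMap_slotProd_eq_zero a s hpq ht (heq ▸ ht)]
    exact hI.1
  push Not at hdup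
  let T : Finset (Fin (2 * d + 1)) := Finset.univ.filter fun p => s (a p) = none
  have hT : d + 1 ≤ T.card := by
    have h1 : Tᶜ.card ≤ (Finset.univ.image (some : Fin n × Fin n → _)).card := by
      refine Finset.card_le_card_of_injOn (fun p => s (a p)) ?_ ?_
      · intro p hp
        have hp' : s (a p) ≠ none := by simpa [T] using hp
        obtain ⟨t, ht⟩ := Option.ne_none_iff_exists'.1 hp'
        simp [ht]
      · intro p hp q hq h
        by_contra hpq
        exact hdup p q hpq (by simpa [T] using hp) h
    have h2 : (Finset.univ.image (some : Fin n × Fin n → _)).card ≤ d := by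
      refine Finset.card_image_le.trans ?_
      simp [hd, sq]
    rw [Finset.card_compl, Fintype.card_fin] at h1
    omega
  obtain ⟨U, hUT, hU⟩ := Finset.exists_subset_card_eq (n := d + 1) (s := T.map a)
    (by rwa [Finset.card_map])
  have hex : ∀ j, ∃ p, p ∈ T ∧ a p = U.orderEmbOfFin hU j := fun j => by
    simpa using hUT (U.orderEmbOfFin_mem hU j)
  choose c hcT hc using hex
  let c' : Fin (d + 1) ↪ Fin (2 * d + 1) := ⟨c, fun i j h => by
    have := congrArg a h
    rw [hc, hc] at this
    exact (U.orderEmbOfFin hU).injective this⟩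
  refine hI.altMap_mem_of_trans c' a (fun H => ?_) H
  have hval : ∀ j, c'.trans a j = U.orderEmbOfFin hU j := fun j => hc j
  obtain ⟨z, y, hzy⟩ := exists_altMap_slotProd_eq_mul_cap (F := F) (c'.trans a)
    (fun i j h => by rw [hval, hval]; exact (U.orderEmbOfFin hU).strictMono h) s
    (fun j => (Finset.mem_filter.1 (hcT j)).2) H
  rw [hzy]
  exact hI.2.2.1 _ _ (cap_mem hd hd1 hI hm _ _)

theorem altMap_natMap_mem {I : Set (QPoly F n)} {d : ℕ} (hd : d = n ^ 2) (hd1 : 1 ≤ d)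
    (hI : IsTIdeal F n I) (hm : ContainsSmall (2 * d) I) {N : ℕ} (a : Fin (2 * d + 1) ↪ Fin N)
    {E : MultilinearMap F (fun _ : Fin N => QPoly F n) (QPoly F n)} (hE : E ∈ natMaps F n N)
    (H : Fin N → QPoly F n) : altMap a E H ∈ I := by
  induction hE using Submodule.span_induction with
  | mem E hE =>
    obtain ⟨s, σ, rfl⟩ := hE
    have h1 := altMap_slotProd_mem hd hd1 hI hm (a.trans σ.symm.toEmbedding) s fun p => H (σ p)
    simp only [altMap_apply, Equiv.Perm.viaEmbedding_trans_equiv] at h1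
    simpa only [altMap_apply, MultilinearMap.domDomCongr_apply] using h1
  | zero => simpa [altMap_apply] using hI.1
  | add E E' _ _ h h' =>
    have := hI.2.1 _ _ h h'
    simpa [altMap_apply, Finset.sum_add_distrib] using this
  | smul c E _ h =>
    have h1 : c • altMap a E H ∈ hI.toSubmodule := Submodule.smul_mem _ _ h
    have h2 : altMap a (c • E) H = c • altMap a E H := by
      simp only [altMap_apply, Finset.smul_sum, _root_.smul_apply]
      exact Finset.sum_congr rfl fun τ _ => smul_comm _ _ _
    rw [h2]
    exact h1

theorem natMap_mem {I : Set (QPoly F n)} {d : ℕ} (hd : d = n ^ 2) (hd1 : 1 ≤ d)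
    (hI : IsTIdeal F n I) (hm : ContainsSmall (2 * d) I) {N : ℕ}
    {E : MultilinearMap F (fun _ : Fin N => QPoly F n) (QPoly F n)} (hE : E ∈ natMaps F n N)
    {κ : Fin N → ℕ} (hid : IsQuasiIdentity F n (E fun p => FreeAlgebra.ι _ (κ p))) :
    E (fun p => FreeAlgebra.ι _ (κ p)) ∈ I := by
  have h1 := isTIdeal_quasiIdentities.sum_stabilizer_mem hE hid
  have h2 : (∑ η ∈ Finset.univ.filter fun η : Equiv.Perm (Fin N) => κ ∘ η = κ,
      E.domDomCongr η) ∈ natMaps F n N :=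
    Submodule.sum_mem _ fun η _ => domDomCongr_mem_natMaps hE η
  have h3 : (∑ η ∈ Finset.univ.filter fun η : Equiv.Perm (Fin N) => κ ∘ η = κ,
      E.domDomCongr η) (fun p => FreeAlgebra.ι _ (p : ℕ)) ∈ I := by
    refine natMap_mem_of_altMap_mem hI hm h2 ?_ fun a => altMap_natMap_mem hd hd1 hI hm a h2 _
    rw [_root_.sum_apply]
    exact h1
  have h4 := hI.subst_fin_mem h2 h3 fun p => FreeAlgebra.ι _ (κ p)
  rw [_root_.sum_apply] at h4
  have h5 : ∀ η ∈ Finset.univ.filter fun η : Equiv.Perm (Fin N) => κ ∘ η = κ,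
      E.domDomCongr η (fun p => FreeAlgebra.ι _ (κ p)) = E fun p => FreeAlgebra.ι _ (κ p) := by
    intro η hη
    have hη' := congrFun (Finset.mem_filter.1 hη).2
    simp only [Function.comp_apply] at hη'
    simp only [MultilinearMap.domDomCongr_apply, hη']
  rw [Finset.sum_congr rfl h5, Finset.sum_const, ← Nat.cast_smul_eq_nsmul F] at h4
  refine hI.mem_of_smul_mem (Nat.cast_ne_zero.2 (Finset.card_ne_zero_of_mem (a := 1) ?_)) h4
  simp

theorem exists_perm_comp_eq_of_perm_ofFn {α : Type*} [LinearOrder α] {N : ℕ} {f g : Fin N → α}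
    (h : (List.ofFn f).Perm (List.ofFn g)) : ∃ σ : Equiv.Perm (Fin N), f = g ∘ σ := by
  have h1 : f ∘ Tuple.sort f = g ∘ Tuple.sort g := by
    refine List.ofFn_injective (List.Perm.eq_of_sortedLE
      (Tuple.monotone_sort f).sortedLE_ofFn (Tuple.monotone_sort g).sortedLE_ofFn ?_)
    exact ((Equiv.Perm.ofFn_comp_perm _ f).trans h).trans (Equiv.Perm.ofFn_comp_perm _ g).symm
  refine ⟨(Tuple.sort f).symm.trans (Tuple.sort g), funext fun p => ?_⟩
  have := congrFun h1 ((Tuple.sort f).symm p)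
  simpa using this

variable (F) in
/-- The monomial attached to a list of slots and variable indices. -/
noncomputable def slotMonomial (l : List (Option (Fin n × Fin n) × ℕ)) : QPoly F n :=
  (l.map fun x => slotMap x.1 (FreeAlgebra.ι (CPoly F n) x.2)).prod

variable (F n) in
/-- The multihomogeneous quasi-polynomials: the variables occur as often as listed in `m`. -/
noncomputable def multidegree (m : Multiset ℕ) : Submodule F (QPoly F n) :=
  Submodule.span F {P | ∃ l : List (Option (Fin n × Fin n) × ℕ),
    ((l.map Prod.snd : List ℕ) : Multiset ℕ) = m ∧ P = slotMonomial F l}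

theorem iSup_multidegree : ⨆ m, multidegree F n m = ⊤ := by
  rw [eq_top_iff]
  have h1 : (⊤ : Submodule F (QPoly F n)) = Subalgebra.toSubmodule ⊤ := rfl
  rw [h1, ← adjoin_variables_eq_top, Algebra.adjoin_eq_span, Submodule.span_le]
  intro P hP
  obtain ⟨L, hL, rfl⟩ := Submonoid.exists_list_of_mem_closure hP
  have h2 : ∃ l : List (Option (Fin n × Fin n) × ℕ), L.prod = slotMonomial F l := by
    clear hP
    induction L with
    | nil => exact ⟨[], rfl⟩
    | cons Q L ih =>
      obtain ⟨l, hl⟩ := ih fun y hy => hL y (List.mem_cons_of_mem _ hy)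
      rcases hL Q List.mem_cons_self with ⟨k, rfl⟩ | ⟨⟨i, j, k⟩, rfl⟩
      · exact ⟨(none, k) :: l, by simp [slotMonomial, slotMap_none, hl]⟩
      · exact ⟨(some (i, j), k) :: l, by
          simp [slotMonomial, slotMap_some, hl, PhiQ_ι, genMat]⟩
  obtain ⟨l, hl⟩ := h2
  rw [hl]
  exact Submodule.mem_iSup_of_mem _ (Submodule.subset_span ⟨l, rfl, rfl⟩)

theorem isWeightedHomogeneous_PhiQ {m : Multiset ℕ} {P : QPoly F n} (hP : P ∈ multidegree F n m)
    (i j : Fin n) :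
    MvPolynomial.IsWeightedHomogeneous (fun p : Fin n × Fin n × ℕ => ({p.2.2} : Multiset ℕ))
      (PhiQ F n P i j) m := by
  induction hP using Submodule.span_induction with
  | mem P hP =>
    obtain ⟨l, rfl, rfl⟩ := hP
    induction l generalizing i j with
    | nil =>
      simp only [slotMonomial, List.map_nil, List.prod_nil, map_one, Matrix.one_apply]
      split_ifs
      · exact MvPolynomial.isWeightedHomogeneous_one _ _
      · exact MvPolynomial.isWeightedHomogeneous_zero _ _ _
    | cons x l ih =>
      have h1 : PhiQ F n (slotMonomial F (x :: l)) =
          PhiQ F n (slotMap x.1 (FreeAlgebra.ι _ x.2)) * PhiQ F n (slotMonomial F l) := by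
        simp [slotMonomial]
      rw [h1, Matrix.mul_apply]
      refine MvPolynomial.IsWeightedHomogeneous.sum _ _ _ fun a _ => ?_
      have h2 : (((x :: l).map Prod.snd : List ℕ) : Multiset ℕ) =
          {x.2} + ((l.map Prod.snd : List ℕ) : Multiset ℕ) := by
        simp
      rw [h2]
      refine MvPolynomial.IsWeightedHomogeneous.mul ?_ (ih a j)
      obtain ⟨t, k⟩ := x
      rcases t with _ | ⟨b, c⟩
      · simp only [slotMap_none, PhiQ_ι, genMat, Matrix.of_apply]
        exact MvPolynomial.isWeightedHomogeneous_X F _ _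
      · simp only [slotMap_some, PhiQ_ι, PhiQ_algebraMap, Matrix.algebraMap_matrix_apply, genMat,
          Matrix.of_apply]
        split_ifs
        · exact MvPolynomial.isWeightedHomogeneous_X F _ _
        · exact MvPolynomial.isWeightedHomogeneous_zero _ _ _
  | zero => simpa using MvPolynomial.isWeightedHomogeneous_zero _ _ _
  | add P Q _ _ h h' => simpa using h.add h'
  | smul c P _ h =>
    have h1 : PhiQ F n (c • P) i j = MvPolynomial.C c * PhiQ F n P i j := by
      rw [← MvPolynomial.smul_eq_C_mul]
      exact congrFun (congrFun (map_smul ((PhiQ F n).restrictScalars F) c P) i) j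
    rw [h1]
    exact h.C_mul c

theorem isQuasiIdentity_component {f : Multiset ℕ →₀ QPoly F n}
    (hf : ∀ m, f m ∈ multidegree F n m) (h : IsQuasiIdentity F n (f.sum fun _ P => P))
    (m : Multiset ℕ) : IsQuasiIdentity F n (f m) := by
  classical
  rw [isQuasiIdentity_iff] at h ⊢
  ext1 i j
  have h1 := congrArg (MvPolynomial.weightedHomogeneousComponent
    (fun p : Fin n × Fin n × ℕ => ({p.2.2} : Multiset ℕ)) m) (congrFun (congrFun h i) j)
  rw [Finsupp.sum, map_sum, Matrix.sum_apply, map_sum] at h1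
  have h2 : ∀ m', MvPolynomial.weightedHomogeneousComponent
      (fun p : Fin n × Fin n × ℕ => ({p.2.2} : Multiset ℕ)) m (PhiQ F n (f m') i j) =
      if m = m' then PhiQ F n (f m') i j else 0 := fun m' =>
    MvPolynomial.weightedHomogeneousComponent_of_mem (isWeightedHomogeneous_PhiQ (hf m') i j)
  simp only [h2, Finset.sum_ite_eq, Matrix.zero_apply, map_zero] at h1
  by_cases hm : m ∈ f.support
  · simpa [hm] using h1
  · simp [Finsupp.notMem_support_iff.1 hm]

theorem exists_natMap_of_mem_multidegree {m : Multiset ℕ} {P : QPoly F n}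
    (hP : P ∈ multidegree F n m) :
    ∃ (N : ℕ) (κ : Fin N → ℕ), ∃ E ∈ natMaps F n N, P = E fun p => FreeAlgebra.ι _ (κ p) := by
  obtain ⟨k, rfl⟩ := Quot.exists_rep m
  refine ⟨k.length, k.get, ?_⟩
  induction hP using Submodule.span_induction with
  | mem P hP =>
    obtain ⟨l, hl, rfl⟩ := hP
    have hl' : (l.map Prod.snd).Perm k := Multiset.coe_eq_coe.1 hl
    have hlen : l.length = k.length := by simpa using hl'.length_eq
    let e : Fin k.length ≃ Fin l.length := finCongr hlen.symm
    have h1 : List.ofFn (fun p => (l.get (e p)).2) = l.map Prod.snd := by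
      refine List.ext_get (by simp [hlen]) fun i _ _ => ?_
      simp [e]
      rfl
    obtain ⟨σ, hσ⟩ := exists_perm_comp_eq_of_perm_ofFn (f := fun p => (l.get (e p)).2)
      (g := k.get) (by rwa [h1, List.ofFn_get])
    refine ⟨_, domDomCongr_mem_natMaps (slotProd_mem_natMaps fun p => (l.get (e p)).1) σ, ?_⟩
    rw [MultilinearMap.domDomCongr_apply, slotProd_apply, slotMonomial]
    congr 1
    refine List.ext_get (by simp [hlen]) fun i hi _ => ?_
    have h2 := congrFun hσ ⟨i, by simpa [hlen] using hi⟩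
    simp only [Function.comp_apply, List.get_eq_getElem] at h2
    simp [← h2, e]
    rfl
  | zero => exact ⟨0, Submodule.zero_mem _, rfl⟩
  | add P Q _ _ h h' =>
    obtain ⟨E, hE, rfl⟩ := h
    obtain ⟨E', hE', rfl⟩ := h'
    exact ⟨E + E', Submodule.add_mem _ hE hE', rfl⟩
  | smul c P _ h =>
    obtain ⟨E, hE, rfl⟩ := h
    exact ⟨c • E, Submodule.smul_mem _ c hE, rfl⟩

/-- A T-ideal that contains the quasi-identities in few variables contains all of them. -/
theorem IsTIdeal.mem_of_isQuasiIdentity (hn : 1 ≤ n) {I : Set (QPoly F n)} (hI : IsTIdeal F n I)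
    (hm : ContainsSmall (2 * n ^ 2) I) {P : QPoly F n} (hP : IsQuasiIdentity F n P) : P ∈ I := by
  have h1 : P ∈ ⨆ m, multidegree F n m := iSup_multidegree (F := F) (n := n) ▸ Submodule.mem_top
  obtain ⟨f, hf, rfl⟩ := (Submodule.mem_iSup_iff_exists_finsupp _ _).1 h1
  refine hI.toSubmodule.sum_mem fun m _ => ?_
  have h2 := isQuasiIdentity_component hf hP m
  obtain ⟨N, κ, E, hE, h⟩ := exists_natMap_of_mem_multidegree (hf m)
  rw [h] at h2 ⊢
  exact natMap_mem rfl (Nat.one_le_pow _ _ hn) hI hm hE h2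

variable (F n) in
/-- The polynomials in the first `m` families of commutative variables. -/
noncomputable def smallPoly (m : ℕ) : Subalgebra F (CPoly F n) :=
  Algebra.adjoin F
    (Set.range fun p : Fin n × Fin n × Fin m => MvPolynomial.X (p.1, p.2.1, (p.2.2 : ℕ)))

instance isNoetherianRing_smallPoly (m : ℕ) : IsNoetherianRing (smallPoly F n m) := by
  have h1 : (smallPoly F n m).FG := Subalgebra.fg_def.2 ⟨_, Set.finite_range _, rfl⟩
  have := Subalgebra.fg_iff_finiteType _ |>.1 h1
  exact Algebra.FiniteType.isNoetherianRing F _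

theorem X_mem_smallPoly {m k : ℕ} (hk : k < m) (i j : Fin n) :
    MvPolynomial.X (i, j, k) ∈ smallPoly F n m :=
  Algebra.subset_adjoin ⟨(i, j, ⟨k, hk⟩), rfl⟩

theorem algebraMap_mem_usesOnlyVars {m : ℕ} {c : CPoly F n} (hc : c ∈ smallPoly F n m) :
    algebraMap (CPoly F n) (QPoly F n) c ∈ usesOnlyVars F n m := by
  have h1 : smallPoly F n m ≤ (usesOnlyVars F n m).comap
      (IsScalarTower.toAlgHom F (CPoly F n) (QPoly F n)) := by
    refine Algebra.adjoin_le ?_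
    rintro _ ⟨⟨i, j, k⟩, rfl⟩
    exact Algebra.subset_adjoin (Or.inr ⟨i, j, k, k.2, rfl⟩)
  exact h1 hc

theorem smallPoly_smul_def {m : ℕ} (a : smallPoly F n m) (P : QPoly F n) :
    a • P = algebraMap (CPoly F n) (QPoly F n) a * P :=
  Algebra.smul_def (a : CPoly F n) P

variable (F n) in
/-- `usesOnlyVars` as a module over its commutative coefficients. -/
noncomputable def smallSubmodule (m : ℕ) : Submodule (smallPoly F n m) (QPoly F n) where
  carrier := usesOnlyVars F n m
  add_mem' := fun ha hb => Subalgebra.add_mem _ ha hb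
  zero_mem' := Subalgebra.zero_mem _
  smul_mem' := fun a P hP => by
    rw [smallPoly_smul_def]
    exact Subalgebra.mul_mem _ (algebraMap_mem_usesOnlyVars a.2) hP

/-- A T-ideal as a module over the small coefficients. -/
noncomputable def IsTIdeal.toSmallSubmodule {I : Set (QPoly F n)} (hI : IsTIdeal F n I) (m : ℕ) :
    Submodule (smallPoly F n m) (QPoly F n) where
  carrier := I
  add_mem' := fun {a b} ha hb => hI.2.1 a b ha hb
  zero_mem' := hI.1
  smul_mem' := fun a P hP => by
    rw [smallPoly_smul_def]
    exact hI.2.2.1 _ _ hP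

variable (F n) in
/-- `Φ` as a linear map over the small coefficients. -/
noncomputable def PhiSmall (m : ℕ) :
    QPoly F n →ₗ[smallPoly F n m] Matrix (Fin n) (Fin n) (CPoly F n) :=
  (PhiQ F n).toLinearMap.restrictScalars (smallPoly F n m)

theorem map_PhiSmall_fg (m : ℕ) : ((smallSubmodule F n m).map (PhiSmall F n m)).FG := by
  let f : Matrix (Fin n) (Fin n) (smallPoly F n m) →ₗ[smallPoly F n m]
      Matrix (Fin n) (Fin n) (CPoly F n) :=
    (Algebra.linearMap (smallPoly F n m) (CPoly F n)).mapMatrix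
  have h1 : (smallSubmodule F n m).map (PhiSmall F n m) ≤ LinearMap.range f := by
    have h2 : usesOnlyVars F n m ≤ ((smallPoly F n m).val.mapMatrix.range).comap
        ((PhiQ F n).restrictScalars F : QPoly F n →ₐ[F] Matrix (Fin n) (Fin n) (CPoly F n)) := by
      refine Algebra.adjoin_le ?_
      rintro _ (⟨k, hk, rfl⟩ | ⟨i, j, k, hk, rfl⟩)
      · refine ⟨Matrix.of fun i j => ⟨MvPolynomial.X (i, j, k), X_mem_smallPoly hk i j⟩, ?_⟩
        change _ = PhiQ F n _
        rw [PhiQ_ι]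
        rfl
      · refine ⟨algebraMap (smallPoly F n m) _ ⟨_, X_mem_smallPoly hk i j⟩, ?_⟩
        change _ = PhiQ F n _
        rw [PhiQ_algebraMap]
        ext1 a b
        by_cases hab : a = b <;> simp [Matrix.algebraMap_matrix_apply, hab]
    rintro _ ⟨P, hP, rfl⟩
    obtain ⟨A, hA⟩ := h2 hP
    exact ⟨A, hA⟩
  have h3 : IsNoetherian (smallPoly F n m) (Matrix (Fin n) (Fin n) (smallPoly F n m)) :=
    isNoetherian_of_isNoetherianRing_of_finite _ _
  rw [← Submodule.map_comap_eq_of_le h1]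
  exact (IsNoetherian.noetherian _).map f

theorem exists_finset_containsSmall (m : ℕ) :
    ∃ S : Finset (QPoly F n), (∀ P ∈ S, IsQuasiIdentity F n P ∧ P ∈ usesOnlyVars F n m) ∧
      ∀ I : Set (QPoly F n), IsTIdeal F n I → (∀ P ∈ I, IsQuasiIdentity F n P) → ↑S ⊆ I →
        ContainsSmall m I := by
  classical
  have h1 := map_PhiSmall_fg (F := F) (n := n) m
  rw [← Submodule.span_eq ((smallSubmodule F n m).map (PhiSmall F n m)),
    Submodule.fg_span_iff_fg_span_finset_subset] at h1
  obtain ⟨T', hT', hspan⟩ := h1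
  rw [Submodule.span_eq] at hspan
  obtain ⟨T, hT, rfl⟩ := Finset.subset_set_image_iff.1 hT'
  let V := Submodule.span (smallPoly F n m) (insert 1 T : Set (QPoly F n))
  have hVW : V ≤ smallSubmodule F n m := by
    refine Submodule.span_le.2 (Set.insert_subset ?_ hT)
    exact Subalgebra.one_mem (usesOnlyVars F n m)
  have hg : ∀ P, ∃ Q, P ∈ usesOnlyVars F n m → Q ∈ V ∧ PhiQ F n Q = PhiQ F n P := by
    intro P
    by_cases hP : P ∈ usesOnlyVars F n m
    · have h2 : PhiSmall F n m P ∈ (smallSubmodule F n m).map (PhiSmall F n m) := ⟨P, hP, rfl⟩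
      rw [hspan, Finset.coe_image, ← Submodule.map_span] at h2
      obtain ⟨Q, hQ, hQP⟩ := h2
      exact ⟨Q, fun _ => ⟨Submodule.span_mono (Set.subset_insert _ _) hQ, hQP⟩⟩
    · exact ⟨0, fun h => absurd h hP⟩
  choose g hgV using hg
  have hVfg : V.FG := Submodule.fg_span (T.finite_toSet.insert 1)
  have hVn : IsNoetherian (smallPoly F n m) V := isNoetherian_of_fg_of_noetherian V hVfg
  obtain ⟨K, hK⟩ := isNoetherian_submodule.1 hVn (V ⊓ LinearMap.ker (PhiSmall F n m)) inf_le_left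
  have hmul : ∀ k < m, ∀ P ∈ V, FreeAlgebra.ι (CPoly F n) k * P ∈ usesOnlyVars F n m :=
    fun k hk P hP => Subalgebra.mul_mem _ (Algebra.subset_adjoin (Or.inl ⟨k, hk, rfl⟩)) (hVW hP)
  have hTV : ∀ P ∈ insert 1 T, P ∈ V := fun P hP => Submodule.subset_span (by simpa using hP)
  refine ⟨K ∪ Finset.image₂ (fun k P => FreeAlgebra.ι (CPoly F n) k * P -
    g (FreeAlgebra.ι (CPoly F n) k * P)) (Finset.range m) (insert 1 T), ?_, ?_⟩
  · intro P hP
    rcases Finset.mem_union.1 hP with hP | hP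
    · have h2 : P ∈ V ⊓ LinearMap.ker (PhiSmall F n m) := hK ▸ Submodule.subset_span hP
      exact ⟨(isQuasiIdentity_iff P).2 h2.2, hVW h2.1⟩
    · obtain ⟨k, hk, w, hw, rfl⟩ := Finset.mem_image₂.1 hP
      have h2 := hmul k (Finset.mem_range.1 hk) w (hTV w hw)
      refine ⟨(isQuasiIdentity_iff _).2 ?_, Subalgebra.sub_mem _ h2 (hVW (hgV _ h2).1)⟩
      rw [map_sub, (hgV _ h2).2, sub_self]
  · intro I hI hIq hS P hP hPq
    let J := V ⊔ hI.toSmallSubmodule m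
    have hιJ : ∀ k < m, ∀ Q ∈ J, FreeAlgebra.ι (CPoly F n) k * Q ∈ J := by
      intro k hk Q hQ
      obtain ⟨v, hv, i, hi, rfl⟩ := Submodule.mem_sup.1 hQ
      rw [mul_add]
      refine J.add_mem ?_ (Submodule.mem_sup_right (hI.2.2.1 _ _ hi))
      clear hQ
      induction hv using Submodule.span_induction with
      | mem w hw =>
        have hw' : w ∈ insert 1 T := by simpa using hw
        have h2 := hmul k hk w (hTV w hw')
        rw [← add_sub_cancel (g (FreeAlgebra.ι (CPoly F n) k * w)) (FreeAlgebra.ι _ k * w)]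
        refine Submodule.add_mem_sup (hgV _ h2).1 (hS ?_)
        exact Finset.mem_union_right _
          (Finset.mem_image₂.2 ⟨k, Finset.mem_range.2 hk, w, hw', rfl⟩)
      | zero => simp
      | add v w _ _ h h' => rw [mul_add]; exact J.add_mem h h'
      | smul a v _ h => rw [mul_smul_comm]; exact J.smul_mem a h
    have hXJ : ∀ i j : Fin n, ∀ k < m, ∀ Q ∈ J,
        algebraMap (CPoly F n) (QPoly F n) (MvPolynomial.X (i, j, k)) * Q ∈ J := by
      intro i j k hk Q hQ
      have := J.smul_mem ⟨_, X_mem_smallPoly hk i j⟩ hQ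
      rwa [smallPoly_smul_def] at this
    have hWJ : ∀ R ∈ usesOnlyVars F n m, ∀ Q ∈ J, R * Q ∈ J := by
      intro R hR
      induction hR using Algebra.adjoin_induction with
      | mem R hR =>
        rcases hR with ⟨k, hk, rfl⟩ | ⟨i, j, k, hk, rfl⟩
        · exact hιJ k hk
        · exact hXJ i j k hk
      | algebraMap c =>
        intro Q hQ
        have := J.smul_mem (algebraMap F (smallPoly F n m) c) hQ
        rwa [smallPoly_smul_def] at this
      | add R R' _ _ h h' => intro Q hQ; rw [add_mul]; exact J.add_mem (h Q hQ) (h' Q hQ)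
      | mul R R' _ _ h h' => intro Q hQ; rw [mul_assoc]; exact h _ (h' Q hQ)
    have hPJ : P ∈ J := by
      have := hWJ P hP 1 (Submodule.mem_sup_left (hTV 1 (Finset.mem_insert_self _ _)))
      rwa [mul_one] at this
    obtain ⟨v, hv, i, hi, rfl⟩ := Submodule.mem_sup.1 hPJ
    refine hI.2.1 _ _ ?_ hi
    have hvK : v ∈ V ⊓ LinearMap.ker (PhiSmall F n m) := by
      refine ⟨hv, ?_⟩
      have h2 := (isQuasiIdentity_iff _).1 hPq
      rwa [map_add, (isQuasiIdentity_iff _).1 (hIq i hi), add_zero] at h2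
    rw [← hK] at hvK
    have hKI : Submodule.span (smallPoly F n m) (K : Set (QPoly F n)) ≤ hI.toSmallSubmodule m :=
      Submodule.span_le.2 fun w hw => hS (Finset.mem_union_left _ hw)
    exact hKI hvK

end

theorem stmt3 (F : Type*) [Field F] [CharZero F] (n : ℕ) (hn : 1 ≤ n) :
    ∃ S : Finset (QPoly F n),
      (∀ P ∈ S, IsQuasiIdentity F n P ∧ P ∈ usesOnlyVars F n (2 * n ^ 2)) ∧
      TIdealSpan F n (S : Set (QPoly F n)) = {P : QPoly F n | IsQuasiIdentity F n P} := by
  obtain ⟨S, hS, hsmall⟩ := exists_finset_containsSmall (F := F) (n := n) (2 * n ^ 2)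
  have hle : TIdealSpan F n (S : Set (QPoly F n)) ⊆ {P | IsQuasiIdentity F n P} :=
    Set.sInter_subset_of_mem ⟨isTIdeal_quasiIdentities, fun P hP => (hS P hP).1⟩
  refine ⟨S, hS, hle.antisymm fun P hP => ?_⟩
  have hI := isTIdeal_TIdealSpan (S : Set (QPoly F n))
  exact hI.mem_of_isQuasiIdentity hn
    (hsmall _ hI hle fun P hP => Set.mem_sInter.2 fun J hJ => hJ.2 hP) hP
end

section
/- Let c be a central polynomial of M_n with zero constant term, and let α ∈ C be the unique element with Φ(c) = α·I. Let F⟨ξ⟩ denote the F-subalgebra of M_n(C) generated by the generic matrices ξ_k (k ∈ ℕ), and let T_n⟨ξ⟩ denote the F-subalgebra of M_n(C) generated by the generic matrices together with all scalar matrices tr(ξ_{k_1}ξ_{k_2}⋯ξ_{k_r})·I for r ≥ 1 and k_1,…,k_r ∈ ℕ. Then for every t ∈ T_n⟨ξ⟩ there exists m ∈ ℕ such that α^m · t ∈ F⟨ξ⟩. (This expresses the equality of central localizations F⟨ξ⟩[c^{-1}] = T_n⟨ξ⟩[c^{-1}].) -/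
open scoped TensorProduct

variable (F : Type*) [Field F] [CharZero F] (n : ℕ)

/-- `F⟨ξ⟩`, the `F`-subalgebra of `M_n(C)` generated by the generic matrices. -/
noncomputable def genMatAlg : Subalgebra F (Matrix (Fin n) (Fin n) (CPoly F n)) :=
  Algebra.adjoin F (Set.range (genMat F n))

/-- `T_n⟨ξ⟩`, the `F`-subalgebra of `M_n(C)` generated by the generic matrices
together with the scalar matrices `tr(ξ_{k_1}⋯ξ_{k_r})·I`. -/
noncomputable def traceGenMatAlg : Subalgebra F (Matrix (Fin n) (Fin n) (CPoly F n)) :=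
  Algebra.adjoin F
    (Set.range (genMat F n) ∪
      {M : Matrix (Fin n) (Fin n) (CPoly F n) | ∃ l : List ℕ, l ≠ [] ∧
        M = algebraMap (CPoly F n) (Matrix (Fin n) (Fin n) (CPoly F n))
              (Matrix.trace ((l.map (genMat F n)).prod))})

namespace Matrix

variable {ι A : Type*} [Fintype ι] [DecidableEq ι] [CommRing A]

open Polynomial in
/-- Jacobi's formula for the formal derivative of a determinant of polynomials. -/
theorem derivative_det_eq_trace_adjugate_mul (B : Matrix ι ι A[X]) :
    derivative B.det = (B.adjugate * B.map derivative).trace := by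
  have h : ∀ i, (B.adjugate * B.map derivative) i i =
      (B.updateCol i fun j => derivative (B j i)).det := by
    intro i
    rw [← cramer_apply, cramer_eq_adjugate_mulVec]
    rfl
  simp only [trace, diag_apply, h, det_apply, derivative_sum, derivative_smul,
    derivative_prod_finset]
  rw [Finset.sum_comm]
  refine Finset.sum_congr rfl fun σ _ => ?_
  rw [← Finset.smul_sum]
  congr 1
  refine Finset.sum_congr rfl fun i _ => ?_
  rw [← Finset.prod_erase_mul _ _ (Finset.mem_univ i)]
  congr 1
  · refine Finset.prod_congr rfl fun j hj => ?_
    rw [updateCol_ne (Finset.ne_of_mem_erase hj)]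
  · simp

open Polynomial in
/-- Newton's identities for the coefficients of `det (1 + X M)` and the traces of powers of `M`. -/
theorem succ_mul_coeff_det_one_add_X_smul (M : Matrix ι ι A) (k : ℕ) :
    ((k : A) + 1) * (det (1 + (X : A[X]) • M.map C)).coeff (k + 1) =
      ∑ i ∈ Finset.range (k + 1),
        (-1) ^ i * (M ^ (i + 1)).trace * (det (1 + (X : A[X]) • M.map C)).coeff (k - i) := by
  set N : Matrix ι ι A[X] := M.map C with hN
  set B : Matrix ι ι A[X] := 1 + (X : A[X]) • N with hB
  have hNpow : ∀ i, (N ^ i).trace = C (M ^ i).trace := by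
    intro i
    rw [hN, ← RingHom.mapMatrix_apply, ← map_pow, RingHom.mapMatrix_apply,
      AddMonoidHom.map_trace C]
  have hder : B.map derivative = N := by
    ext1 i j
    simp [hB, hN, Matrix.one_apply, apply_ite]
  have hP : derivative B.det = (B.adjugate * N).trace := by
    rw [derivative_det_eq_trace_adjugate_mul, hder]
  have hgeom : B * ∑ i ∈ Finset.range (k + 1), (-((X : A[X]) • N)) ^ i =
      1 - (-((X : A[X]) • N)) ^ (k + 1) := by
    rw [← mul_neg_geom_sum, sub_neg_eq_add]
  have key : derivative B.det = (B.det) * ∑ i ∈ Finset.range (k + 1),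
        ((-1) ^ i * X ^ i * C (M ^ (i + 1)).trace)
      + X ^ (k + 1) * ((-1) ^ (k + 1) * (B.adjugate * N ^ (k + 1) * N).trace) := by
    have h1 : B.adjugate * (B * ∑ i ∈ Finset.range (k + 1), (-((X : A[X]) • N)) ^ i) * N =
        B.adjugate * (1 - (-((X : A[X]) • N)) ^ (k + 1)) * N := by rw [hgeom]
    rw [← mul_assoc, adjugate_mul] at h1
    have hneg : ∀ i, (-((X : A[X]) • N)) ^ i = ((-1) ^ i * X ^ i : A[X]) • N ^ i := by
      intro i
      rw [← neg_smul, _root_.smul_pow, neg_pow]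
    simp only [hneg] at h1
    have h2 := congrArg trace h1
    simp only [Matrix.smul_mul, one_mul, Finset.sum_mul, trace_smul, trace_sum, ← pow_succ, hNpow,
      smul_eq_mul, mul_sub, sub_mul, mul_one, trace_sub, Matrix.mul_smul] at h2
    rw [h2, hP]
    ring
  have h3 := congrArg (fun p => coeff p k) key
  simp only [coeff_derivative, coeff_add, coeff_X_pow_mul', Finset.mul_sum, finsetSum_coeff] at h3
  rw [mul_comm, h3, if_neg (by omega), add_zero]
  refine Finset.sum_congr rfl fun i hi => ?_
  have h4 : B.det * ((-1) ^ i * X ^ i * C (M ^ (i + 1)).trace) =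
      X ^ i * (C ((-1) ^ i * (M ^ (i + 1)).trace) * B.det) := by
    simp only [map_mul, map_pow, map_neg, map_one]; ring
  rw [h4, coeff_X_pow_mul', if_pos (by simpa [Nat.lt_succ_iff] using hi), coeff_C_mul]

open Polynomial in
/-- If the traces of the powers of `M` lie in a subalgebra `Z` and those of the powers `M ^ k`,
`k ≥ 2`, lie in a `Z`-stable submodule, then so does a power of the trace of `M`. -/
theorem trace_pow_succ_card_mem {F : Type*} [Field F] [CharZero F] [Algebra F A]
    (Z : Subalgebra F A) (I : Submodule F A) (hI : ∀ z ∈ Z, ∀ a ∈ I, z * a ∈ I)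
    (M : Matrix ι ι A) (hZ : ∀ k, (M ^ (k + 1)).trace ∈ Z) (h : ∀ k, (M ^ (k + 2)).trace ∈ I) :
    M.trace ^ (Fintype.card ι + 1) ∈ I := by
  set e : ℕ → A := fun k => (det (1 + (X : A[X]) • M.map C)).coeff k with he
  have he0 : e 0 = 1 := by
    simp [he, coeff_zero_eq_eval_zero, eval_det]
  have hrec : ∀ k : ℕ, ((k : A) + 1) * e (k + 1) =
      ∑ i ∈ Finset.range (k + 1), (-1) ^ i * (M ^ (i + 1)).trace * e (k - i) :=
    succ_mul_coeff_det_one_add_X_smul M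
  have hcast : ∀ (k : ℕ) (a : A), ((k : A) + 1) * a = ((k : F) + 1) • a := by
    intro k a
    rw [Algebra.smul_def]; simp
  have heZ : ∀ k, e k ∈ Z := by
    intro k
    induction k using Nat.strong_induction_on with
    | _ k ih =>
      obtain _ | k := k
      · rw [he0]; exact Z.one_mem
      · have h1 : ((k : F) + 1) • e (k + 1) ∈ Z := by
          rw [← hcast, hrec]
          refine Z.sum_mem fun i _ => Z.mul_mem (Z.mul_mem ?_ (hZ i)) (ih _ (by omega))
          exact Z.pow_mem (Z.neg_mem Z.one_mem) _
        have h2 := Z.smul_mem h1 ((k : F) + 1)⁻¹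
        rwa [smul_smul, inv_mul_cancel₀ (Nat.cast_add_one_ne_zero k), one_smul] at h2
  have hpow : ∀ k, (k.factorial : F) • e k - M.trace ^ k ∈ I := by
    intro k
    induction k with
    | zero => simp [he0]
    | succ k ih =>
      have h1 : ((k : F) + 1) • e (k + 1) - M.trace * e k ∈ I := by
        rw [← hcast, hrec, Finset.sum_range_succ']
        simp only [pow_zero, one_mul, zero_add, pow_one, Nat.sub_zero, add_sub_cancel_right]
        refine I.sum_mem fun i _ => ?_
        rw [mul_right_comm]
        exact hI _ (Z.mul_mem (Z.pow_mem (Z.neg_mem Z.one_mem) _) (heZ _)) _ (h i)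
      have hM : M.trace ∈ Z := by simpa using hZ 0
      have h2 := I.add_mem (I.smul_mem (k.factorial : F) h1) (hI _ hM _ ih)
      convert h2 using 1
      rw [smul_sub, smul_smul, mul_sub, mul_smul_comm, Nat.factorial_succ, pow_succ']
      push_cast
      rw [mul_comm ((k : F) + 1)]
      abel
  have hdeg : e (Fintype.card ι + 1) = 0 := by
    apply coeff_eq_zero_of_natDegree_lt
    have := natDegree_det_X_add_C_le M (1 : Matrix ι ι A)
    rw [add_comm, Matrix.map_one C C.map_zero C.map_one] at this
    omega
  have := hpow (Fintype.card ι + 1)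
  rw [hdeg, smul_zero, zero_sub] at this
  exact (I.neg_mem_iff).1 this

end Matrix

namespace MvPolynomial

/-- Euler's identity over a finite set containing all the variables of the polynomial. -/
theorem IsHomogeneous.sum_X_mul_pderiv_of_vars_subset {σ R : Type*} [CommSemiring R]
    {φ : MvPolynomial σ R} {d : ℕ} (h : φ.IsHomogeneous d) {t : Finset σ} (ht : φ.vars ⊆ t) :
    ∑ i ∈ t, X i * pderiv i φ = d • φ := by
  classical
  conv_lhs => rw [φ.as_sum]
  conv_rhs => rw [φ.as_sum]
  simp only [map_sum, Finset.mul_sum, Finset.smul_sum]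
  rw [Finset.sum_comm]
  refine Finset.sum_congr rfl fun m hm => ?_
  simp_rw [X_mul_pderiv_monomial]
  rw [← Finset.sum_smul]
  congr 1
  have hd := h (mem_support_iff.1 hm)
  rw [← hd, Finsupp.weight_apply, Finsupp.sum]
  have hsub : m.support ⊆ t := fun i hi => ht (mem_vars_iff_mem_support i |>.2 ⟨m, hm, hi⟩)
  rw [Finset.sum_subset hsub]
  · simp
  · intro i _ hi
    simpa using hi

end MvPolynomial

section GenericMatrices

open Matrix MvPolynomial

/-- The scalars `z` such that `z · I` lies in `F⟨ξ⟩`. -/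
noncomputable def scalarSubalgebra : Subalgebra F (CPoly F n) :=
  (genMatAlg F n).comap
    (IsScalarTower.toAlgHom F (CPoly F n) (Matrix (Fin n) (Fin n) (CPoly F n)))

omit [CharZero F] in
theorem mem_scalarSubalgebra {z : CPoly F n} :
    z ∈ scalarSubalgebra F n ↔
      algebraMap (CPoly F n) (Matrix (Fin n) (Fin n) (CPoly F n)) z ∈ genMatAlg F n :=
  Iff.rfl

/-- The matrices `b` such that `z ↦ tr(bz) · I` and `y ↦ tr(y) b` preserve `F⟨ξ⟩`. -/
noncomputable def traceIdeal : Submodule F (Matrix (Fin n) (Fin n) (CPoly F n)) where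
  carrier := {b | ∀ y ∈ genMatAlg F n,
    (b * y).trace ∈ scalarSubalgebra F n ∧ y.trace • b ∈ genMatAlg F n}
  zero_mem' := fun y _ => by simp
  add_mem' := fun {a b} ha hb y hy => by
    rw [add_mul, trace_add, smul_add]
    exact ⟨add_mem (ha y hy).1 (hb y hy).1, add_mem (ha y hy).2 (hb y hy).2⟩
  smul_mem' := fun r b hb y hy => by
    rw [smul_mul_assoc, trace_smul, smul_comm]
    exact ⟨Subalgebra.smul_mem _ (hb y hy).1 r, Subalgebra.smul_mem _ (hb y hy).2 r⟩

/-- The scalars `z` such that `y ↦ z tr(y) · I` preserves `F⟨ξ⟩`. -/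
noncomputable def traceConductor : Submodule F (CPoly F n) where
  carrier := {z | ∀ y ∈ genMatAlg F n, z * y.trace ∈ scalarSubalgebra F n}
  zero_mem' := fun y _ => by simp
  add_mem' := fun {a b} ha hb y hy => by
    rw [add_mul]
    exact add_mem (ha y hy) (hb y hy)
  smul_mem' := fun r b hb y hy => by
    rw [smul_mul_assoc]
    exact Subalgebra.smul_mem _ (hb y hy) r

variable {F n}

omit [CharZero F] in
theorem mul_mem_traceIdeal {b r : Matrix (Fin n) (Fin n) (CPoly F n)}
    (hb : b ∈ traceIdeal F n) (hr : r ∈ genMatAlg F n) : b * r ∈ traceIdeal F n := by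
  intro y hy
  refine ⟨?_, ?_⟩
  · rw [mul_assoc]; exact (hb _ (mul_mem hr hy)).1
  · rw [← smul_mul_assoc]; exact mul_mem (hb y hy).2 hr

theorem mem_genMatAlg_of_mem_traceIdeal (hn : 1 ≤ n) {b : Matrix (Fin n) (Fin n) (CPoly F n)}
    (hb : b ∈ traceIdeal F n) : b ∈ genMatAlg F n := by
  have h := (hb 1 (one_mem _)).2
  have h1 : (1 : Matrix (Fin n) (Fin n) (CPoly F n)).trace • b = (n : F) • b := by
    rw [trace_one, Fintype.card_fin, Nat.cast_smul_eq_nsmul, Nat.cast_smul_eq_nsmul]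
  rw [h1] at h
  have h2 := Subalgebra.smul_mem _ h (n : F)⁻¹
  rwa [smul_smul, inv_mul_cancel₀ (Nat.cast_ne_zero.2 (by omega)), one_smul] at h2

omit [CharZero F] in
theorem trace_mul_mem_traceConductor {a b : Matrix (Fin n) (Fin n) (CPoly F n)}
    (ha : a ∈ traceIdeal F n) (hb : b ∈ traceIdeal F n) :
    (a * b).trace ∈ traceConductor F n := by
  intro y hy
  have := (ha _ (hb y hy).2).1
  rwa [Matrix.mul_smul, trace_smul, smul_eq_mul, mul_comm] at this

theorem trace_pow_mem_traceConductor (hn : 1 ≤ n) {a : Matrix (Fin n) (Fin n) (CPoly F n)}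
    (ha : a ∈ traceIdeal F n) : a.trace ^ (n + 1) ∈ traceConductor F n := by
  have haR := mem_genMatAlg_of_mem_traceIdeal hn ha
  have hpow : ∀ k, a ^ (k + 1) ∈ traceIdeal F n := fun k => by
    rw [pow_succ']; exact mul_mem_traceIdeal ha (pow_mem haR k)
  have := trace_pow_succ_card_mem (scalarSubalgebra F n) (traceConductor F n)
    (fun z hz b hb y hy => by rw [mul_assoc]; exact mul_mem hz (hb y hy)) a
    (fun k => by simpa using (hpow k 1 (one_mem _)).1)
    (fun k => by rw [pow_succ']; exact trace_mul_mem_traceConductor ha (hpow k))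
  rwa [Fintype.card_fin] at this

/-- The derivation of `C` sending `ξ_k` to `z` and the other generic matrices to `0`. -/
noncomputable def matDeriv (k : ℕ) (z : Matrix (Fin n) (Fin n) (CPoly F n)) :
    Derivation F (CPoly F n) (CPoly F n) :=
  mkDerivation F fun p => if p.2.2 = k then z p.1 p.2.1 else 0

/-- The matrix of partial derivatives representing the differential of `α` in the direction `ξ_k`
through the trace form. -/
noncomputable def gradMat (k : ℕ) (α : CPoly F n) : Matrix (Fin n) (Fin n) (CPoly F n) :=
  Matrix.of fun i j => pderiv (j, i, k) α

omit [CharZero F] in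
theorem matDeriv_apply (k : ℕ) (z : Matrix (Fin n) (Fin n) (CPoly F n)) (α : CPoly F n) :
    matDeriv k z α = (gradMat k α * z).trace := by
  let D : Derivation F (CPoly F n) (CPoly F n) :=
    ∑ i, ∑ j, z i j • pderiv (i, j, k)
  have hDapply : ∀ x, D x = ∑ i, ∑ j, z i j * pderiv (i, j, k) x := fun x => by
    simp only [D, ← Derivation.coeFnAddMonoidHom_apply, map_sum, Finset.sum_apply]
    rfl
  have hD : matDeriv k z = D := by
    refine derivation_ext fun p => ?_
    obtain ⟨i, j, l⟩ := p
    simp only [hDapply, matDeriv, mkDerivation_X, pderiv_X, Pi.single_apply, Prod.mk.injEq]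
    by_cases h : l = k
    · subst h
      simp [ite_and]
    · simp [h]
  rw [hD, hDapply]
  simp only [trace, diag_apply, Matrix.mul_apply, gradMat, Matrix.of_apply]
  rw [Finset.sum_comm]
  exact Finset.sum_congr rfl fun i _ => Finset.sum_congr rfl fun j _ => mul_comm _ _

omit [CharZero F] in
/-- The differential of an element of `F⟨ξ⟩` is a generalized polynomial `z ↦ ∑ aᵢ z bᵢ`; it
preserves `F⟨ξ⟩`, and so does its transpose `y ↦ ∑ bᵢ y aᵢ`. -/
theorem exists_transpose_matDeriv (k : ℕ) {r : Matrix (Fin n) (Fin n) (CPoly F n)}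
    (hr : r ∈ genMatAlg F n) :
    (∀ z ∈ genMatAlg F n, r.map (matDeriv k z) ∈ genMatAlg F n) ∧
    ∃ g : Matrix (Fin n) (Fin n) (CPoly F n) → Matrix (Fin n) (Fin n) (CPoly F n),
      (∀ y ∈ genMatAlg F n, g y ∈ genMatAlg F n) ∧
      ∀ z y, (r.map (matDeriv k z) * y).trace = (z * g y).trace := by
  induction hr using Algebra.adjoin_induction with
  | mem x hx =>
    obtain ⟨l, rfl⟩ := hx
    have h : ∀ z, (genMat F n l).map (matDeriv k z) = if l = k then z else 0 := by
      intro z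
      ext1 i j
      simp only [genMat, Matrix.map_apply, Matrix.of_apply, matDeriv, mkDerivation_X]
      split_ifs <;> rfl
    simp only [h]
    split_ifs with hlk
    · exact ⟨fun z hz => hz, id, fun y hy => hy, fun z y => rfl⟩
    · exact ⟨fun z _ => zero_mem _, fun _ => 0, fun _ _ => zero_mem _, by simp⟩
  | algebraMap c =>
    have h : ∀ z, (algebraMap F (Matrix (Fin n) (Fin n) (CPoly F n)) c).map (matDeriv k z) = 0 := by
      intro z
      ext1 i j
      rw [Matrix.map_apply, Matrix.algebraMap_matrix_apply]
      split_ifs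
      · exact Derivation.map_algebraMap _ c
      · exact map_zero _
    simp only [h]
    exact ⟨fun z _ => zero_mem _, fun _ => 0, fun _ _ => zero_mem _, by simp⟩
  | add a b _ _ iha ihb =>
    obtain ⟨ha, ga, hga, hta⟩ := iha
    obtain ⟨hb, gb, hgb, htb⟩ := ihb
    have h : ∀ z, (a + b).map (matDeriv k z) = a.map (matDeriv k z) + b.map (matDeriv k z) :=
      fun z => Matrix.map_add _ (map_add _) a b
    simp only [h]
    refine ⟨fun z hz => add_mem (ha z hz) (hb z hz), fun y => ga y + gb y,
      fun y hy => add_mem (hga y hy) (hgb y hy), fun z y => ?_⟩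
    rw [add_mul, mul_add, trace_add, trace_add, hta, htb]
  | mul a b ha' hb' iha ihb =>
    obtain ⟨ha, ga, hga, hta⟩ := iha
    obtain ⟨hb, gb, hgb, htb⟩ := ihb
    have h : ∀ z, (a * b).map (matDeriv k z) =
        a * b.map (matDeriv k z) + a.map (matDeriv k z) * b := by
      intro z
      ext1 i j
      simp only [Matrix.map_apply, Matrix.mul_apply, Matrix.add_apply, map_sum, Derivation.leibniz,
        smul_eq_mul, Finset.sum_add_distrib]
      congr 1
      exact Finset.sum_congr rfl fun l _ => mul_comm _ _
    simp only [h]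
    refine ⟨fun z hz => add_mem (mul_mem ha' (hb z hz)) (mul_mem (ha z hz) hb'),
      fun y => gb (y * a) + ga (b * y),
      fun y hy => add_mem (hgb _ (mul_mem hy ha')) (hga _ (mul_mem hb' hy)), fun z y => ?_⟩
    rw [add_mul, mul_add, trace_add, trace_add, ← htb, ← hta, mul_assoc, trace_mul_comm a,
      mul_assoc, mul_assoc]

omit [CharZero F] in
theorem gradMat_mem_traceIdeal (k : ℕ) {α : CPoly F n} (hα : α ∈ scalarSubalgebra F n) :
    gradMat k α ∈ traceIdeal F n := by
  obtain ⟨hf, g, hg, ht⟩ := exists_transpose_matDeriv k ((mem_scalarSubalgebra F n).1 hα)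
  have h : ∀ z, (algebraMap (CPoly F n) (Matrix (Fin n) (Fin n) (CPoly F n)) α).map
      (matDeriv k z) =
      algebraMap (CPoly F n) (Matrix (Fin n) (Fin n) (CPoly F n)) (gradMat k α * z).trace := by
    intro z
    ext1 i j
    rw [Matrix.map_apply, Matrix.algebraMap_matrix_apply, Matrix.algebraMap_matrix_apply]
    split_ifs
    · exact matDeriv_apply k z α
    · exact map_zero _
  simp only [h] at hf ht
  refine fun y hy => ⟨hf y hy, ?_⟩
  convert hg y hy using 1
  refine Matrix.ext_iff_trace_mul_left.2 fun z => ?_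
  rw [← ht, Algebra.algebraMap_eq_smul_one, Matrix.smul_mul, one_mul, Matrix.mul_smul, trace_smul,
    trace_smul, smul_eq_mul, smul_eq_mul, mul_comm, trace_mul_comm]

omit [CharZero F] in
theorem map_homogeneousComponent_mem_genMatAlg (d : ℕ)
    {r : Matrix (Fin n) (Fin n) (CPoly F n)} (hr : r ∈ genMatAlg F n) :
    r.map (homogeneousComponent d) ∈ genMatAlg F n := by
  have hr' : r ∈ Submodule.span F (Submonoid.closure (Set.range (genMat F n)) :
      Set (Matrix (Fin n) (Fin n) (CPoly F n))) := by
    rw [← Algebra.adjoin_eq_span]; exact hr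
  induction hr' using Submodule.span_induction with
  | mem w hw =>
    have hom : ∃ l, ∀ i j, (w i j).IsHomogeneous l := by
      clear hr
      induction hw using Submonoid.closure_induction with
      | mem x hx =>
        obtain ⟨k, rfl⟩ := hx
        exact ⟨1, fun i j => isHomogeneous_X _ _⟩
      | one =>
        refine ⟨0, fun i j => ?_⟩
        rw [Matrix.one_apply]
        split_ifs
        · exact isHomogeneous_one _ _
        · exact isHomogeneous_zero _ _ _
      | mul a b _ _ iha ihb =>
        obtain ⟨k, hk⟩ := iha
        obtain ⟨l, hl⟩ := ihb
        refine ⟨k + l, fun i j => ?_⟩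
        rw [Matrix.mul_apply]
        exact IsHomogeneous.sum _ _ _ fun p _ => (hk i p).mul (hl p j)
    obtain ⟨l, hl⟩ := hom
    have h : w.map (homogeneousComponent d) = if l = d then w else 0 := by
      ext1 i j
      rw [Matrix.map_apply, homogeneousComponent_of_mem (hl i j)]
      simp only [eq_comm (a := d)]
      split_ifs <;> rfl
    rw [h]
    split_ifs
    · exact hr
    · exact zero_mem _
  | zero =>
    rw [Matrix.map_zero _ (map_zero _)]; exact zero_mem _
  | add a b ha hb iha ihb =>
    rw [Matrix.map_add _ (map_add _)]
    rw [← Algebra.adjoin_eq_span] at ha hb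
    exact add_mem (iha ha) (ihb hb)
  | smul c a ha iha =>
    rw [Matrix.map_smul _ c (fun x => map_smul _ c x)]
    rw [← Algebra.adjoin_eq_span] at ha
    exact Subalgebra.smul_mem _ (iha ha) c

omit [CharZero F] in
theorem homogeneousComponent_mem_scalarSubalgebra (d : ℕ) {α : CPoly F n}
    (hα : α ∈ scalarSubalgebra F n) : homogeneousComponent d α ∈ scalarSubalgebra F n := by
  have h := map_homogeneousComponent_mem_genMatAlg d ((mem_scalarSubalgebra F n).1 hα)
  rw [mem_scalarSubalgebra]
  convert h using 1
  ext1 i j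
  rw [Matrix.map_apply, Matrix.algebraMap_matrix_apply, Matrix.algebraMap_matrix_apply]
  split_ifs
  · rfl
  · exact (map_zero _).symm

omit [CharZero F] in
theorem genMat_mem (k : ℕ) : genMat F n k ∈ genMatAlg F n :=
  Algebra.subset_adjoin ⟨k, rfl⟩

theorem exists_trace_eq_of_isHomogeneous {d : ℕ} (hd : d ≠ 0) {α : CPoly F n}
    (hom : α.IsHomogeneous d) (hα : α ∈ scalarSubalgebra F n) :
    ∃ a ∈ traceIdeal F n, a.trace = α := by
  classical
  let s : Finset ℕ := α.vars.image fun p => p.2.2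
  refine ⟨(d : F)⁻¹ • ∑ k ∈ s, gradMat k α * genMat F n k, Submodule.smul_mem _ _
    (Submodule.sum_mem _ fun k _ => mul_mem_traceIdeal (gradMat_mem_traceIdeal k hα)
      (genMat_mem k)), ?_⟩
  have hs : α.vars ⊆ (Finset.univ : Finset (Fin n)) ×ˢ (Finset.univ : Finset (Fin n)) ×ˢ s := by
    intro p hp
    simp only [Finset.mem_product, Finset.mem_univ, true_and]
    exact Finset.mem_image_of_mem (fun p => p.2.2) hp
  have hE := hom.sum_X_mul_pderiv_of_vars_subset hs
  have hsum : ∑ k ∈ s, (gradMat k α * genMat F n k).trace = d • α := by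
    rw [← hE, Finset.sum_product]
    simp only [Finset.sum_product, trace, diag_apply, Matrix.mul_apply, gradMat, genMat,
      Matrix.of_apply]
    rw [Finset.sum_comm]
    rw [Finset.sum_congr rfl fun j _ => Finset.sum_comm, Finset.sum_comm]
    refine Finset.sum_congr rfl fun i _ => Finset.sum_congr rfl fun j _ =>
      Finset.sum_congr rfl fun k _ => mul_comm _ _
  rw [trace_smul, trace_sum, hsum, ← Nat.cast_smul_eq_nsmul F, smul_smul,
    inv_mul_cancel₀ (Nat.cast_ne_zero.2 hd), one_smul]

theorem exists_trace_eq {α : CPoly F n} (hα : α ∈ scalarSubalgebra F n)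
    (h0 : constantCoeff α = 0) : ∃ a ∈ traceIdeal F n, a.trace = α := by
  suffices h : α ∈ (traceIdeal F n).map (traceLinearMap (Fin n) F (CPoly F n)) by
    simpa using h
  rw [← sum_homogeneousComponent α]
  refine Submodule.sum_mem _ fun d _ => ?_
  by_cases hd : d = 0
  · subst hd
    rw [homogeneousComponent_zero, ← constantCoeff_eq, h0, C_0]
    exact zero_mem _
  · obtain ⟨a, ha, hta⟩ := exists_trace_eq_of_isHomogeneous hd
      (homogeneousComponent_isHomogeneous d α) (homogeneousComponent_mem_scalarSubalgebra d hα)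
    exact ⟨a, ha, hta⟩

omit [CharZero F] in
theorem PhiQ_toQPoly_mem (c : NCPoly F) : PhiQ F n (toQPoly F n c) ∈ genMatAlg F n := by
  induction c using FreeAlgebra.induction with
  | grade0 r => simp
  | grade1 k => simpa [toQPoly, PhiQ] using genMat_mem k
  | mul a b ha hb => rw [map_mul, map_mul]; exact mul_mem ha hb
  | add a b ha hb => rw [map_add, map_add]; exact add_mem ha hb

omit [CharZero F] in
theorem map_constantCoeff_PhiQ_toQPoly (c : NCPoly F) :
    (PhiQ F n (toQPoly F n c)).map constantCoeff =
      algebraMap F (Matrix (Fin n) (Fin n) F) (constantTerm F c) := by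
  induction c using FreeAlgebra.induction with
  | grade0 r =>
    ext1 i j
    rw [AlgHom.commutes, AlgHom.commutes, IsScalarTower.algebraMap_apply F (CPoly F n),
      AlgHom.commutes, Matrix.map_apply, Matrix.algebraMap_matrix_apply,
      Matrix.algebraMap_matrix_apply]
    split_ifs <;> simp [MvPolynomial.algebraMap_eq]
  | grade1 k =>
    ext1 i j
    simp [toQPoly, PhiQ, constantTerm, genMat]
  | mul a b ha hb => rw [map_mul, map_mul, Matrix.map_mul, ha, hb, map_mul, map_mul]
  | add a b ha hb =>
    rw [map_add, map_add, Matrix.map_add _ (map_add _), ha, hb, map_add, map_add]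

omit [CharZero F] in
theorem list_prod_genMat_mem (l : List ℕ) : (l.map (genMat F n)).prod ∈ genMatAlg F n :=
  list_prod_mem fun x hx => by
    obtain ⟨k, _, rfl⟩ := List.mem_map.1 hx
    exact genMat_mem k

omit [CharZero F] in
theorem exists_pow_smul_mem_genMatAlg {β : CPoly F n} (hβ : β ∈ traceConductor F n)
    (hβZ : β ∈ scalarSubalgebra F n) {t : Matrix (Fin n) (Fin n) (CPoly F n)}
    (ht : t ∈ traceGenMatAlg F n) : ∃ m : ℕ, β ^ m • t ∈ genMatAlg F n := by
  have hup : ∀ {t : Matrix (Fin n) (Fin n) (CPoly F n)} {m : ℕ} (l : ℕ),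
      β ^ m • t ∈ genMatAlg F n → β ^ (l + m) • t ∈ genMatAlg F n := by
    intro t m l h
    have := mul_mem ((mem_scalarSubalgebra F n).1 (pow_mem hβZ l)) h
    rwa [← Algebra.smul_def, smul_smul, ← pow_add] at this
  induction ht using Algebra.adjoin_induction with
  | mem x hx =>
    obtain ⟨k, rfl⟩ | ⟨l, -, rfl⟩ := hx
    · exact ⟨0, by simpa using genMat_mem k⟩
    · refine ⟨1, ?_⟩
      have := hβ _ (list_prod_genMat_mem l)
      rw [mem_scalarSubalgebra, map_mul, ← Algebra.smul_def] at this
      rwa [pow_one]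
  | algebraMap r => exact ⟨0, by simp⟩
  | add a b _ _ iha ihb =>
    obtain ⟨k, hk⟩ := iha
    obtain ⟨l, hl⟩ := ihb
    refine ⟨k + l, ?_⟩
    rw [smul_add]
    exact add_mem (by rw [add_comm]; exact hup l hk) (hup k hl)
  | mul a b _ _ iha ihb =>
    obtain ⟨k, hk⟩ := iha
    obtain ⟨l, hl⟩ := ihb
    refine ⟨k + l, ?_⟩
    rw [pow_add, ← smul_mul_smul_comm]
    exact mul_mem hk hl

end GenericMatrices

theorem stmt4 (F : Type*) [Field F] [CharZero F] (n : ℕ) (hn : 1 ≤ n)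
    (c : NCPoly F) (hc : IsCentralPoly F n c) (hc0 : constantTerm F c = 0)
    (α : CPoly F n)
    (hα : PhiQ F n (toQPoly F n c) =
      algebraMap (CPoly F n) (Matrix (Fin n) (Fin n) (CPoly F n)) α) :
    ∀ t ∈ traceGenMatAlg F n, ∃ m : ℕ, α ^ m • t ∈ genMatAlg F n := by
  have hαZ : α ∈ scalarSubalgebra F n := by
    rw [mem_scalarSubalgebra, ← hα]
    exact PhiQ_toQPoly_mem c
  have h0 : MvPolynomial.constantCoeff α = 0 := by
    have h := map_constantCoeff_PhiQ_toQPoly (n := n) c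
    rw [hα, hc0, map_zero] at h
    simpa [Matrix.algebraMap_matrix_apply] using congrFun (congrFun h ⟨0, hn⟩) ⟨0, hn⟩
  obtain ⟨a, ha, rfl⟩ := exists_trace_eq hαZ h0
  intro t ht
  obtain ⟨m, hm⟩ := exists_pow_smul_mem_genMatAlg (trace_pow_mem_traceConductor hn ha)
    (pow_mem hαZ _) ht
  exact ⟨(n + 1) * m, by rwa [pow_mul]⟩
end
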